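/- arXiv:1510.05012 — 3 statements merged into one kernel-verified Lean document; each statement's English description precedes it below -/
import Mathlib

section
/- Every affine coordinate subspace {x} × R^k ⊆ R^d with k ≥ 2 is of Khintchine type for divergence: for every nonincreasing ψ : N → R^+ with ∑_{q∈N} ψ(q)^d = ∞, for almost every y ∈ R^k (with respect to k-dimensional Lebesgue measure) there exist infinitely many q ∈ N with ‖q(x,y)‖ < ψ(q). -/
open scoped Classical
open MeasureTheory Filter

/-- Sup-norm distance from `x ∈ ℝ^ℓ` to the nearest integer point of `ℤ^ℓ`. -/
noncomputable def distInt {l : ℕ} (x : Fin l → ℝ) : ℝ :=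
  ⨅ p : Fin l → ℤ, ‖x - fun i => (p i : ℝ)‖


lemma pow_diff_aux (k l : ℕ) (hk : 1 ≤ k) (a b : ℝ) (hb : 0 ≤ b) (hab : b ≤ a) :
    a ^ (l + k) - b ^ (l + k) ≤ (l + 1) * (a ^ l * (a ^ k - b ^ k)) := by
  obtain ⟨j, rfl⟩ : ∃ j, k = j + 1 := ⟨k - 1, by omega⟩
  have ha : 0 ≤ a := hb.trans hab
  have h1 : a ^ j * (a - b) ≤ a ^ (j+1) - b ^ (j+1) := by
    have : b ^ j ≤ a ^ j := pow_le_pow_left₀ hb hab j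
    rw [pow_succ, pow_succ]
    nlinarith
  induction l with
  | zero => simp
  | succ l ih =>
    have h2 : b ^ (l + (j+1)) ≤ a ^ (l + (j+1)) := pow_le_pow_left₀ hb hab _
    have h3 : b ^ (l + (j+1)) * (a - b) ≤ a ^ (l+1) * (a ^ (j+1) - b ^ (j+1)) := by
      calc b ^ (l + (j+1)) * (a - b) ≤ a ^ (l + (j+1)) * (a - b) :=
            mul_le_mul_of_nonneg_right h2 (by linarith)
        _ = a ^ (l+1) * (a ^ j * (a - b)) := by ring
        _ ≤ _ := mul_le_mul_of_nonneg_left h1 (by positivity)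
    have h4 := mul_le_mul_of_nonneg_left ih ha
    have e1 : a ^ (l + 1 + (j + 1)) = a * a ^ (l + (j+1)) := by ring
    have e2 : b ^ (l + 1 + (j + 1)) = b * b ^ (l + (j+1)) := by ring
    rw [e1, e2]
    push_cast
    have e3 : a * ((↑l + 1) * (a ^ l * (a ^ (j + 1) - b ^ (j + 1)))) = (l+1) * (a ^ (l+1) * (a ^ (j+1) - b ^ (j+1))) := by ring
    rw [e3] at h4
    linarith

lemma partial_sum_aux (k l : ℕ) (hk : 1 ≤ k) (φ : ℕ → ℝ) (hpos : ∀ q, 0 < φ q)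
    (hmono : Antitone φ) (a : ℕ → ℝ) (c : ℝ) (hc : 0 ≤ c)
    (hA : ∀ N, c * N * φ N ^ l - 1 ≤ ∑ q ∈ Finset.range N, a (q+1)) (N : ℕ) :
    c / (l + 1) * ∑ q ∈ Finset.range N, φ (q+1) ^ (l + k) - φ 0 ^ k ≤
      ∑ q ∈ Finset.range N, a (q+1) * φ (q+1) ^ k := by
  have key : ∀ N, c / (l + 1) * (∑ q ∈ Finset.range N, φ (q+1) ^ (l + k) - N * φ N ^ (l+k))
      - (φ 0 ^ k - φ N ^ k) ≤
      ∑ q ∈ Finset.range N, a (q+1) * φ (q+1) ^ k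
        - (∑ q ∈ Finset.range N, a (q+1)) * φ N ^ k := by
    intro N
    induction N with
    | zero => simp
    | succ N ih =>
      simp only [Finset.sum_range_succ]
      have h1 := pow_diff_aux k l hk (φ N) (φ (N+1)) (hpos _).le (hmono (Nat.le_succ N))
      have h2 : 0 ≤ φ N ^ k - φ (N+1) ^ k :=
        sub_nonneg.2 (pow_le_pow_left₀ (hpos _).le (hmono (Nat.le_succ N)) k)
      have h3 := mul_le_mul_of_nonneg_right (hA N) h2
      have h4 := mul_le_mul_of_nonneg_left h1 (show 0 ≤ c / (l+1) * N by positivity)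
      have e : c / (l+1) * N * ((l + 1) * (φ N ^ l * (φ N ^ k - φ (N+1) ^ k)))
        = c * N * φ N ^ l * (φ N ^ k - φ (N+1) ^ k) := by
        field_simp
      rw [e] at h4
      push_cast
      linarith
  have h := key N
  have h1 := mul_le_mul_of_nonneg_right (hA N) (pow_nonneg (hpos N).le k)
  have h2 : c / (l+1) * (N * φ N ^ (l+k)) ≤ c * N * φ N ^ l * φ N ^ k := by
    have : c / (l+1) ≤ c := div_le_self hc (by have : (0:ℝ) ≤ l := by positivity
                                               linarith)
    calc c / (l+1) * (N * φ N ^ (l+k)) ≤ c * (N * φ N ^ (l+k)) :=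
          mul_le_mul_of_nonneg_right this (by have := hpos N; positivity)
      _ = _ := by ring
  linarith

lemma pigeon_aux (l : ℕ) (x : Fin l → ℝ) (δ : ℝ) (hδ : 0 < δ) (hδ1 : δ ≤ 1) (N : ℕ) :
    (1/2)^l * N * δ ^ l - 1 ≤
      ∑ q ∈ Finset.range N, (if ∃ n : Fin l → ℤ, ∀ i, |((q+1 : ℕ):ℝ) * x i - n i| < δ then (1:ℝ) else 0) := by
  set M : ℕ := ⌈1/δ⌉₊ with hM
  have hM0 : 0 < M := Nat.ceil_pos.2 (by positivity)
  have hM1 : (1:ℝ)/δ ≤ M := Nat.le_ceil _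
  have hM2 : (M:ℝ) ≤ 2 / δ := by
    have h := (Nat.ceil_lt_add_one (show (0:ℝ) ≤ 1/δ by positivity)).le
    have : 1 ≤ 1/δ := by rw [le_div_iff₀ hδ]; linarith
    calc (M:ℝ) ≤ 1/δ + 1 := h
      _ ≤ 1/δ + 1/δ := by linarith
      _ = 2/δ := by ring
  have hM0' : (0:ℝ) < M := by exact_mod_cast hM0
  let f : ℕ → (Fin l → Fin M) := fun q i => ⟨⌊(M:ℝ) * Int.fract ((q:ℝ) * x i)⌋₊, by
    rw [Nat.floor_lt (mul_nonneg hM0'.le (Int.fract_nonneg _))]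
    have := Int.fract_lt_one ((q:ℝ) * x i)
    nlinarith⟩
  have hf : ∀ q r : ℕ, f q = f r → ∀ i, |Int.fract ((q:ℝ) * x i) - Int.fract ((r:ℝ) * x i)| < δ := by
    intro q r h i
    have h1 : ⌊(M:ℝ) * Int.fract ((q:ℝ) * x i)⌋₊ = ⌊(M:ℝ) * Int.fract ((r:ℝ) * x i)⌋₊ := by
      have := congrFun h i
      simpa [f] using this
    have p1 := Nat.floor_le (mul_nonneg hM0'.le (Int.fract_nonneg ((q:ℝ) * x i)))
    have p2 := Nat.lt_floor_add_one ((M:ℝ) * Int.fract ((q:ℝ) * x i))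
    have p3 := Nat.floor_le (mul_nonneg hM0'.le (Int.fract_nonneg ((r:ℝ) * x i)))
    have p4 := Nat.lt_floor_add_one ((M:ℝ) * Int.fract ((r:ℝ) * x i))
    rw [h1] at p1 p2
    have p5 : |(M:ℝ) * (Int.fract ((q:ℝ) * x i) - Int.fract ((r:ℝ) * x i))| < 1 := by
      rw [abs_lt]; constructor <;> linarith
    rw [abs_mul, abs_of_pos hM0'] at p5
    rw [div_le_iff₀ hδ] at hM1
    by_contra hcon
    push Not at hcon
    have := mul_le_mul_of_nonneg_left hcon hM0'.le
    linarith
  obtain ⟨z, -, hz⟩ := Finset.exists_le_card_fiber_of_nsmul_le_card_of_maps_to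
    (s := Finset.range (N+1)) (t := (Finset.univ : Finset (Fin l → Fin M))) (f := f)
    (b := ((N+1 : ℕ):ℝ) / (M:ℝ)^l) (fun _ _ => Finset.mem_univ _)
    ⟨fun _ => ⟨0, hM0⟩, Finset.mem_univ _⟩ (by
      simp only [Finset.card_univ, Fintype.card_fun, Fintype.card_fin, nsmul_eq_mul, Finset.card_range]
      push_cast
      rw [mul_div_cancel₀ _ (by positivity)])
  set F := Finset.filter (fun q => f q = z) (Finset.range (N+1)) with hF
  have hFne : F.Nonempty := by
    rw [← Finset.card_pos]
    have : (0:ℝ) < F.card := lt_of_lt_of_le (by positivity) hz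
    exact_mod_cast this
  set m := F.min' hFne with hm
  have hmF : m ∈ F := Finset.min'_mem _ _
  have hinj : F.card - 1 ≤ (Finset.filter (fun q : ℕ => ∃ n : Fin l → ℤ, ∀ i, |((q+1 : ℕ):ℝ) * x i - n i| < δ) (Finset.range N)).card := by
    rw [← Finset.card_erase_of_mem hmF]
    refine Finset.card_le_card_of_injOn (fun q => q - m - 1) ?_ ?_
    · intro q hq
      simp only [Finset.coe_erase, Set.mem_sdiff, Finset.mem_coe, Set.mem_singleton_iff] at hq
      have hlt : m < q := lt_of_le_of_ne (Finset.min'_le _ _ hq.1) (Ne.symm hq.2)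
      have hq1 := Finset.mem_filter.1 hq.1
      have hm1 := Finset.mem_filter.1 hmF
      simp only [Finset.coe_filter, Finset.mem_range, Set.mem_ofPred_eq]
      have hq2 := Finset.mem_range.1 hq1.1
      refine ⟨by omega, fun i => ⌊(q:ℝ) * x i⌋ - ⌊(m:ℝ) * x i⌋, fun i => ?_⟩
      have := hf q m (hq1.2.trans hm1.2.symm) i
      have e : q - m - 1 + 1 = q - m := by omega
      rw [e, Nat.cast_sub hlt.le]
      rw [Int.fract, Int.fract] at this
      push_cast
      convert this using 2
      ring
    · intro q hq r hr hqr
      simp only [Finset.coe_erase, Set.mem_sdiff, Finset.mem_coe, Set.mem_singleton_iff] at hq hr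
      have hlt : m < q := lt_of_le_of_ne (Finset.min'_le _ _ hq.1) (Ne.symm hq.2)
      have hlt' : m < r := lt_of_le_of_ne (Finset.min'_le _ _ hr.1) (Ne.symm hr.2)
      simp only at hqr
      omega
  rw [Finset.sum_boole]
  have h1 : (F.card : ℝ) - 1 ≤ (Finset.filter (fun q : ℕ => ∃ n : Fin l → ℤ, ∀ i, |((q+1 : ℕ):ℝ) * x i - n i| < δ) (Finset.range N)).card := by
    have : F.card ≤ (Finset.filter (fun q : ℕ => ∃ n : Fin l → ℤ, ∀ i, |((q+1 : ℕ):ℝ) * x i - n i| < δ) (Finset.range N)).card + 1 := by omega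
    have : (F.card:ℝ) ≤ _ := Nat.cast_le.2 this
    push_cast at this ⊢
    linarith
  refine le_trans ?_ h1
  have h2 : (1/2)^l * N * δ ^ l ≤ ((N+1 : ℕ):ℝ) / (M:ℝ)^l := by
    rw [le_div_iff₀ (by positivity)]
    have h3 : (M:ℝ)^l ≤ (2/δ)^l := pow_le_pow_left₀ hM0'.le hM2 l
    calc (1/2)^l * N * δ ^ l * (M:ℝ)^l ≤ (1/2)^l * N * δ ^ l * (2/δ)^l :=
          mul_le_mul_of_nonneg_left h3 (by positivity)
      _ = N * ((1/2) * δ * (2/δ))^l := by rw [mul_pow, mul_pow]; ring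
      _ = N := by
        have : (1/2) * δ * (2/δ) = 1 := by field_simp
        rw [this]; simp
      _ ≤ _ := by push_cast; linarith
  linarith

noncomputable def primSet (k q : ℕ) : Finset (Fin k → ℕ) :=
  (Fintype.piFinset fun _ => Finset.range q).filter
    (fun a => ∀ e, 2 ≤ e → e ∣ q → ∃ i, ¬ e ∣ a i)

lemma sum_inv_sq_aux (q : ℕ) : ∑ e ∈ Finset.Icc 2 q, (1:ℝ) / (e:ℝ)^2 ≤ 3/4 := by
  have h : ∀ n : ℕ, ∑ e ∈ Finset.Icc 2 (n+2), (1:ℝ) / (e:ℝ)^2 ≤ 3/4 - 1/((n:ℝ)+2) + 0 := by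
    intro n
    induction n with
    | zero => norm_num
    | succ n ih =>
      rw [show n + 1 + 2 = (n+2)+1 by ring, Finset.sum_Icc_succ_top (by omega)]
      have : (1:ℝ) / ((n + 2 + 1 : ℕ):ℝ)^2 ≤ 1/((n:ℝ)+2) - 1/(((n+1:ℕ):ℝ)+2) := by
        push_cast
        rw [div_sub_div _ _ (by positivity) (by positivity), div_le_div_iff₀ (by positivity) (by positivity)]
        have : (0:ℝ) ≤ n := by positivity
        nlinarith
      linarith
  rcases Nat.lt_or_ge q 2 with h2 | h2
  · rw [Finset.Icc_eq_empty (by omega)]; norm_num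
  · obtain ⟨n, rfl⟩ := Nat.exists_eq_add_of_le' h2
    refine (h n).trans ?_
    have : (0:ℝ) ≤ 1/((n:ℝ)+2) := by positivity
    linarith

lemma primSet_card_lower (k q : ℕ) (hk : 2 ≤ k) (hq : 1 ≤ q) :
    (q:ℝ)^k / 4 ≤ (primSet k q).card := by
  set P := Fintype.piFinset fun _ : Fin k => Finset.range q with hP
  have hPc : P.card = q ^ k := by simp [hP]
  have hsplit := Finset.card_filter_add_card_filter_not (s := P)
    (fun a => ∀ e, 2 ≤ e → e ∣ q → ∃ i, ¬ e ∣ a i)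
  have hbad : (P.filter (fun a => ¬ ∀ e, 2 ≤ e → e ∣ q → ∃ i, ¬ e ∣ a i)) ⊆
      ((Finset.Icc 2 q).filter (fun e => e ∣ q)).biUnion
        (fun e => Fintype.piFinset fun _ : Fin k => (Finset.range q).filter (fun a => e ∣ a)) := by
    intro a ha
    rw [Finset.mem_filter] at ha
    obtain ⟨ha1, ha2⟩ := ha
    push Not at ha2
    obtain ⟨e, he, heq, hi⟩ := ha2
    rw [Finset.mem_biUnion]
    refine ⟨e, ?_, ?_⟩
    · simp only [Finset.mem_filter, Finset.mem_Icc]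
      exact ⟨⟨he, Nat.le_of_dvd (by omega) heq⟩, heq⟩
    · rw [Fintype.mem_piFinset]
      intro i
      rw [Finset.mem_filter]
      exact ⟨Fintype.mem_piFinset.1 ha1 i, hi i⟩
  have hcard : ∀ e ∈ (Finset.Icc 2 q).filter (fun e => e ∣ q),
      (((Fintype.piFinset fun _ : Fin k => (Finset.range q).filter (fun a => e ∣ a)).card : ℕ):ℝ)
        ≤ (q:ℝ)^k * (1 / (e:ℝ)^2) := by
    intro e he
    simp only [Finset.mem_filter, Finset.mem_Icc] at he
    obtain ⟨⟨he2, heq⟩, c, rfl⟩ := he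
    have h1 : ((Finset.range (e*c)).filter (fun a => e ∣ a)).card ≤ c := by
      have : (Finset.range (e*c)).filter (fun a => e ∣ a) ⊆ (Finset.range c).image (fun m => e * m) := by
        intro a ha
        simp only [Finset.mem_filter, Finset.mem_range] at ha
        obtain ⟨h, m, rfl⟩ := ha
        rw [Finset.mem_image]
        exact ⟨m, Finset.mem_range.2 (lt_of_mul_lt_mul_left h (Nat.zero_le _)), rfl⟩
      calc _ ≤ _ := Finset.card_le_card this
        _ ≤ _ := Finset.card_image_le
        _ = c := Finset.card_range c
    rw [Fintype.card_piFinset, Finset.prod_const, Finset.card_univ, Fintype.card_fin]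
    have he0 : (1:ℝ) ≤ e := by exact_mod_cast (by omega : 1 ≤ e)
    calc (((((Finset.range (e*c)).filter (fun a => e ∣ a)).card ^ k : ℕ)):ℝ)
        ≤ ((c^k : ℕ):ℝ) := by exact_mod_cast Nat.pow_le_pow_left h1 k
      _ = (c:ℝ)^k := by push_cast; rfl
      _ ≤ ((e:ℝ)*c)^k * (1/(e:ℝ)^2) := by
        rw [mul_pow, mul_one_div, le_div_iff₀ (by positivity), mul_comm]
        exact mul_le_mul_of_nonneg_right (pow_le_pow_right₀ he0 hk) (by positivity)
      _ = _ := by push_cast; rfl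
  have hb2 : (((P.filter (fun a => ¬ ∀ e, 2 ≤ e → e ∣ q → ∃ i, ¬ e ∣ a i)).card : ℕ):ℝ) ≤ (q:ℝ)^k * (3/4) := by
    calc _ ≤ (((((Finset.Icc 2 q).filter (fun e => e ∣ q)).biUnion
        (fun e => Fintype.piFinset fun _ : Fin k => (Finset.range q).filter (fun a => e ∣ a))).card : ℕ):ℝ) := by
          exact_mod_cast Finset.card_le_card hbad
      _ ≤ ∑ e ∈ (Finset.Icc 2 q).filter (fun e => e ∣ q), (((Fintype.piFinset fun _ : Fin k => (Finset.range q).filter (fun a => e ∣ a)).card : ℕ):ℝ) := by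
          exact_mod_cast Finset.card_biUnion_le
      _ ≤ ∑ e ∈ (Finset.Icc 2 q).filter (fun e => e ∣ q), (q:ℝ)^k * (1 / (e:ℝ)^2) := Finset.sum_le_sum hcard
      _ ≤ ∑ e ∈ Finset.Icc 2 q, (q:ℝ)^k * (1 / (e:ℝ)^2) :=
          Finset.sum_le_sum_of_subset_of_nonneg (Finset.filter_subset _ _) (fun _ _ _ => by positivity)
      _ = (q:ℝ)^k * ∑ e ∈ Finset.Icc 2 q, (1 / (e:ℝ)^2) := by rw [Finset.mul_sum]
      _ ≤ _ := mul_le_mul_of_nonneg_left (sum_inv_sq_aux q) (by positivity)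
  rw [hPc] at hsplit
  have hs : (((P.filter (fun a => ∀ e, 2 ≤ e → e ∣ q → ∃ i, ¬ e ∣ a i)).card : ℕ):ℝ) +
    (((P.filter (fun a => ¬ ∀ e, 2 ≤ e → e ∣ q → ∃ i, ¬ e ∣ a i)).card : ℕ):ℝ) = (q:ℝ)^k := by
    exact_mod_cast hsplit
  have : (primSet k q) = P.filter (fun a => ∀ e, 2 ≤ e → e ∣ q → ∃ i, ¬ e ∣ a i) := rfl
  rw [this]
  linarith

lemma primSet_card_upper (k q : ℕ) : ((primSet k q).card : ℝ) ≤ (q:ℝ)^k := by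
  have : (primSet k q).card ≤ q ^ k := by
    refine (Finset.card_filter_le _ _).trans ?_
    simp
  exact_mod_cast this

/-- pairs of integers with close fractions -/
noncomputable def pairSet (q r : ℕ) (L : ℝ) : Finset (ℕ × ℕ) :=
  (Finset.range q ×ˢ Finset.range r).filter
    (fun p => |(p.1:ℝ) * r - (p.2:ℝ) * q| < L)

lemma pairSet_card (q r : ℕ) (hq : 1 ≤ q) (hr : 1 ≤ r) (L : ℝ) (hL : (Nat.gcd q r : ℝ) ≤ L) :
    ((pairSet q r L).card : ℝ) ≤ 3 * L := by
  obtain ⟨g, q', r', hg, hcop, hq', hr'⟩ := Nat.exists_coprime' (m := q) (n := r)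
    (Nat.gcd_pos_of_pos_left _ hq)
  have hgg : Nat.gcd q r = g := by
    rw [hq', hr', Nat.gcd_mul_right, hcop.gcd_eq_one, one_mul]
  rw [hgg] at hL
  have hq'0 : 0 < q' := Nat.pos_of_ne_zero (by rintro rfl; simp at hq'; omega)
  have hr'0 : 0 < r' := Nat.pos_of_ne_zero (by rintro rfl; simp at hr'; omega)
  have hg' : (0:ℝ) < g := by exact_mod_cast hg
  let f : ℕ × ℕ → ℤ := fun p => (p.1:ℤ) * r' - (p.2:ℤ) * q'
  have hfib : ∀ b ∈ (pairSet q r L).image f, ((pairSet q r L).filter (fun p => f p = b)).card ≤ g := by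
    intro b _
    rw [← Finset.card_range g]
    refine Finset.card_le_card_of_injOn (fun p => p.2 / r') ?_ ?_
    · intro p hp
      simp only [pairSet, Finset.coe_filter, Finset.mem_filter, Finset.mem_product, Finset.mem_range, Set.mem_ofPred_eq] at hp
      simp only [Finset.coe_range, Set.mem_Iio]
      rw [Nat.div_lt_iff_lt_mul hr'0, mul_comm, ← hr']
      exact hp.1.1.2
    · intro p hp p' hp' hpp
      simp only [pairSet, Finset.coe_filter, Finset.mem_filter, Finset.mem_product, Finset.mem_range, Set.mem_ofPred_eq] at hp hp'
      have h1 : f p = f p' := hp.2.trans hp'.2.symm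
      simp only [f] at h1
      simp only at hpp
      have h2 : ((p.1:ℤ) - p'.1) * r' = ((p.2:ℤ) - p'.2) * q' := by linarith
      have h3 : (r':ℤ) ∣ ((p.2:ℤ) - p'.2) := by
        have : (r':ℤ) ∣ ((p.2:ℤ) - p'.2) * q' := Dvd.intro_left _ h2
        exact IsCoprime.dvd_of_dvd_mul_right (Nat.isCoprime_iff_coprime.2 hcop.symm) this
      have h4 : p.2 % r' = p'.2 % r' := by
        have h6 : (p.2:ℤ) % r' = (p'.2:ℤ) % r' := Int.emod_eq_emod_iff_emod_sub_eq_zero.2 (Int.emod_eq_zero_of_dvd h3)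
        exact_mod_cast h6
      have h5 : p.2 = p'.2 := by
        rw [← Nat.div_add_mod p.2 r', ← Nat.div_add_mod p'.2 r', hpp, h4]
      have h6 : p.1 = p'.1 := by
        rw [h5] at h2
        have hr'' : (r':ℤ) ≠ 0 := by exact_mod_cast hr'0.ne'
        have : ((p.1:ℤ) - p'.1) * r' = 0 := by rw [h2]; ring
        rcases mul_eq_zero.1 this with h | h
        · omega
        · exact absurd h hr''
      exact Prod.ext h6 h5
  have himg : ((pairSet q r L).image f) ⊆ Finset.Icc (-⌊L/g⌋) ⌊L/g⌋ := by
    intro n hn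
    rw [Finset.mem_image] at hn
    obtain ⟨p, hp, rfl⟩ := hn
    simp only [pairSet, Finset.mem_filter] at hp
    have h1 : |((f p : ℤ):ℝ)| < L / g := by
      rw [lt_div_iff₀ hg', ← abs_of_pos hg', ← abs_mul]
      have e : ((f p : ℤ):ℝ) * g = (p.1:ℝ) * r - (p.2:ℝ) * q := by
        rw [hq', hr']
        simp only [f]
        push_cast
        ring
      rw [e]
      exact hp.2
    rw [abs_lt] at h1
    rw [Finset.mem_Icc]
    constructor
    · rw [neg_le]; apply Int.le_floor.2; push_cast; linarith
    · apply Int.le_floor.2; linarith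
  have hfl : (0:ℤ) ≤ ⌊L/g⌋ := Int.floor_nonneg.2 (div_nonneg (hg'.le.trans hL) hg'.le)
  have h1 : (pairSet q r L).card ≤ g * (Finset.Icc (-⌊L/g⌋) ⌊L/g⌋).card :=
    (Finset.card_le_mul_card_image _ g hfib).trans (Nat.mul_le_mul_left _ (Finset.card_le_card himg))
  rw [Int.card_Icc] at h1
  have h2 : (((⌊L/g⌋ + 1 - -⌊L/g⌋).toNat : ℕ) : ℝ) = 2 * (⌊L/g⌋:ℝ) + 1 := by
    have : (((⌊L/g⌋ + 1 - -⌊L/g⌋).toNat : ℕ) : ℤ) = 2 * ⌊L/g⌋ + 1 := by omega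
    exact_mod_cast congrArg (Int.cast : ℤ → ℝ) this
  calc ((pairSet q r L).card : ℝ) ≤ (g:ℝ) * (((⌊L/g⌋ + 1 - -⌊L/g⌋).toNat : ℕ) : ℝ) := by exact_mod_cast h1
    _ = g * (2 * (⌊L/g⌋:ℝ) + 1) := by rw [h2]
    _ ≤ g * (2 * (L/g) + 1) := by
      have := Int.floor_le (L/g)
      apply mul_le_mul_of_nonneg_left _ hg'.le
      linarith
    _ = 2 * L + g := by field_simp
    _ ≤ 3 * L := by linarith

noncomputable def closePairs (k q r : ℕ) (L : ℝ) : Finset ((Fin k → ℕ) × (Fin k → ℕ)) :=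
  (primSet k q ×ˢ primSet k r).filter
    (fun p => ∀ i, |(p.1 i:ℝ) * r - (p.2 i:ℝ) * q| < L)

lemma prim_dvd (k q r : ℕ) (hq : 1 ≤ q) (a b : Fin k → ℕ) (ha : a ∈ primSet k q)
    (h : ∀ i, a i * r = b i * q) : q ∣ r := by
  obtain ⟨g, q', r', hg, hcop, hq', hr'⟩ := Nat.exists_coprime' (m := q) (n := r)
    (Nat.gcd_pos_of_pos_left _ hq)
  have hq'0 : 0 < q' := Nat.pos_of_ne_zero (by rintro rfl; simp at hq'; omega)
  have hd : ∀ i, q' ∣ a i := by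
    intro i
    have h1 := h i
    rw [hq', hr', ← mul_assoc, ← mul_assoc] at h1
    have h2 := Nat.eq_of_mul_eq_mul_right hg h1
    exact hcop.dvd_of_dvd_mul_right ⟨b i, by rw [h2]; ring⟩
  have h1 : q' = 1 := by
    by_contra hne
    obtain ⟨i, hi⟩ := (Finset.mem_filter.1 ha).2 q' (by omega) ⟨g, hq'⟩
    exact hi (hd i)
  rw [hq', hr', h1, one_mul]
  exact dvd_mul_left _ _

lemma closePairs_card (k q r : ℕ) (hq : 1 ≤ q) (hr : 1 ≤ r) (hqr : q ≠ r) (L : ℝ) (hL : 0 ≤ L) :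
    ((closePairs k q r L).card : ℝ) ≤ (3 * L)^k := by
  rcases le_or_gt (Nat.gcd q r : ℝ) L with h | h
  · have h1 : (closePairs k q r L).card ≤ (pairSet q r L).card ^ k := by
      have : (Fintype.piFinset fun _ : Fin k => pairSet q r L).card = (pairSet q r L).card ^ k := by simp
      rw [← this]
      refine Finset.card_le_card_of_injOn (fun p i => (p.1 i, p.2 i)) ?_ ?_
      · intro p hp
        simp only [closePairs, primSet, Finset.coe_filter, Finset.mem_product, Finset.mem_filter, Fintype.mem_piFinset, Set.mem_ofPred_eq] at hp
        simp only [Finset.mem_coe, Fintype.mem_piFinset]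
        intro i
        simp only [pairSet, Finset.mem_filter, Finset.mem_product]
        exact ⟨⟨hp.1.1.1 i, hp.1.2.1 i⟩, hp.2 i⟩
      · intro p _ p' _ hpp
        refine Prod.ext ?_ ?_
        · funext i; exact congrArg Prod.fst (congrFun hpp i)
        · funext i; exact congrArg Prod.snd (congrFun hpp i)
    calc ((closePairs k q r L).card : ℝ) ≤ ((pairSet q r L).card : ℝ)^k := by exact_mod_cast h1
      _ ≤ _ := pow_le_pow_left₀ (by positivity) (pairSet_card q r hq hr L h) k
  · have : closePairs k q r L = ∅ := by
      rw [Finset.eq_empty_iff_forall_notMem]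
      intro p hp
      simp only [closePairs, Finset.mem_product, Finset.mem_filter] at hp
      have hz : ∀ i, p.1 i * r = p.2 i * q := by
        intro i
        have h1 := (hp.2 i).trans h
        have h2 : |(p.1 i:ℤ) * r - (p.2 i:ℤ) * q| < (Nat.gcd q r : ℤ) := by exact_mod_cast h1
        have h3 : (Nat.gcd q r : ℤ) ∣ (p.1 i:ℤ) * r - (p.2 i:ℤ) * q :=
          dvd_sub (Dvd.dvd.mul_left (by exact_mod_cast Nat.gcd_dvd_right q r) _)
            (Dvd.dvd.mul_left (by exact_mod_cast Nat.gcd_dvd_left q r) _)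
        have h4 := Int.eq_zero_of_abs_lt_dvd h3 h2
        have h5 : (p.1 i:ℤ) * r = (p.2 i:ℤ) * q := by linarith
        exact_mod_cast h5
      exact hqr (Nat.dvd_antisymm (prim_dvd k q r hq p.1 p.2 hp.1.1 hz)
        (prim_dvd k r q hr p.2 p.1 hp.1.2 (fun i => (hz i).symm)))
    rw [this]
    simp only [Finset.card_empty, Nat.cast_zero]
    positivity

noncomputable def eSet (k : ℕ) (φ : ℕ → ℝ) (q : ℕ) : Set (Fin k → ℝ) :=
  ⋃ a ∈ primSet k q, Metric.ball (fun i => (a i:ℝ) / q) (φ q / q)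

lemma ball_real_vol (k : ℕ) (c : Fin k → ℝ) (ρ : ℝ) (hρ : 0 < ρ) :
    volume.real (Metric.ball c ρ) = (2 * ρ)^k := by
  rw [Measure.real, Real.volume_pi_ball c hρ, ENNReal.toReal_ofReal (by positivity), Fintype.card_fin]

lemma eSet_meas (k : ℕ) (φ : ℕ → ℝ) (q : ℕ) : MeasurableSet (eSet k φ q) :=
  Finset.measurableSet_biUnion _ (fun _ _ => Metric.isOpen_ball.measurableSet)

lemma eSet_upper (k : ℕ) (φ : ℕ → ℝ) (q : ℕ) (hq : 1 ≤ q) (hφ : 0 < φ q) :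
    volume.real (eSet k φ q) ≤ (2 * φ q)^k := by
  have hq0 : (0:ℝ) < q := by exact_mod_cast hq
  calc volume.real (eSet k φ q) ≤ ∑ a ∈ primSet k q, volume.real (Metric.ball (fun i => (a i:ℝ) / q) (φ q / q)) :=
        measureReal_biUnion_finset_le _ _
    _ = (primSet k q).card * (2 * (φ q / q))^k := by
        simp_rw [ball_real_vol k _ (φ q / q) (by positivity)]
        simp
    _ ≤ (q:ℝ)^k * (2 * (φ q / q))^k := mul_le_mul_of_nonneg_right (primSet_card_upper k q) (by positivity)
    _ = (2 * φ q)^k := by rw [← mul_pow]; congr 1; field_simp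

lemma eSet_lower (k : ℕ) (hk : 2 ≤ k) (φ : ℕ → ℝ) (q : ℕ) (hq : 1 ≤ q) (hφ : 0 < φ q) (hφ2 : φ q ≤ 1/2) :
    (2 * φ q)^k / 4 ≤ volume.real (eSet k φ q) := by
  have hq0 : (0:ℝ) < q := by exact_mod_cast hq
  have hdisj : ((primSet k q : Finset (Fin k → ℕ)) : Set (Fin k → ℕ)).PairwiseDisjoint
      (fun a => Metric.ball (fun i => (a i:ℝ) / q) (φ q / q)) := by
    intro a _ b _ hab
    rw [Function.onFun, Set.disjoint_left]
    intro y hya hyb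
    apply hab
    funext i
    rw [Metric.mem_ball, dist_pi_lt_iff (by positivity)] at hya hyb
    have h1 := hya i
    have h2 := hyb i
    rw [Real.dist_eq] at h1 h2
    have h3 : |(a i : ℝ)/q - (b i:ℝ)/q| < 1 / q := by
      calc |(a i : ℝ)/q - (b i:ℝ)/q| = |(y i - (b i:ℝ)/q) - (y i - (a i:ℝ)/q)| := by congr 1; ring
        _ ≤ |y i - (b i:ℝ)/q| + |y i - (a i:ℝ)/q| := abs_sub _ _
        _ < φ q / q + φ q / q := by linarith
        _ = (φ q + φ q) / q := by ring
        _ ≤ 1 / q := by gcongr; linarith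
    rw [← sub_div, abs_div, abs_of_pos hq0, div_lt_div_iff_of_pos_right hq0] at h3
    have h4 : |(a i : ℤ) - b i| < 1 := by exact_mod_cast h3
    rw [Int.abs_lt_one_iff] at h4
    omega
  have h : volume.real (eSet k φ q) = ∑ a ∈ primSet k q, volume.real (Metric.ball (fun i => (a i:ℝ) / q) (φ q / q)) :=
    measureReal_biUnion_finset hdisj (fun _ _ => Metric.isOpen_ball.measurableSet)
      (fun _ _ => measure_ball_lt_top.ne)
  rw [h]
  simp_rw [ball_real_vol k _ (φ q / q) (by positivity)]
  rw [Finset.sum_const, nsmul_eq_mul]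
  calc (2 * φ q)^k / 4 = (q:ℝ)^k / 4 * (2 * (φ q / q))^k := by
        rw [div_mul_eq_mul_div, ← mul_pow]; congr 2; field_simp
    _ ≤ _ := mul_le_mul_of_nonneg_right (primSet_card_lower k q hk hq) (by positivity)

lemma eSet_subset (k : ℕ) (φ : ℕ → ℝ) (q : ℕ) (hq : 1 ≤ q) (hφ : 0 < φ q) (hφ2 : φ q ≤ 1/2) :
    eSet k φ q ⊆ Metric.closedBall 0 2 := by
  have hq0 : (1:ℝ) ≤ q := by exact_mod_cast hq
  intro y hy
  simp only [eSet, Set.mem_iUnion] at hy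
  obtain ⟨a, ha, hy⟩ := hy
  rw [Metric.mem_ball, dist_pi_lt_iff (by positivity)] at hy
  rw [Metric.mem_closedBall, dist_pi_le_iff (by norm_num)]
  intro i
  have h1 := hy i
  have h2 := Finset.mem_range.1 (Fintype.mem_piFinset.1 (Finset.mem_filter.1 ha).1 i)
  have h3 : (a i:ℝ)/q ≤ 1 := by
    rw [div_le_one (by linarith)]
    exact_mod_cast h2.le
  have h4 : (0:ℝ) ≤ (a i:ℝ)/q := by positivity
  have h5 : φ q / q ≤ 1/2 := by
    rw [div_le_iff₀ (by linarith)]; linarith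
  rw [Real.dist_eq] at h1 ⊢
  rw [abs_lt] at h1
  simp only [Pi.zero_apply, sub_zero]
  rw [abs_le]
  constructor <;> linarith

lemma eSet_overlap (k : ℕ) (φ : ℕ → ℝ) (q r : ℕ) (hq : 1 ≤ q) (hr : 1 ≤ r) (hqr : q ≠ r)
    (hφq : 0 < φ q) (hφr : 0 < φ r) :
    volume.real (eSet k φ q ∩ eSet k φ r) ≤ 3^k * ((2 * φ q)^k * (2 * φ r)^k) := by
  have hq0 : (0:ℝ) < q := by exact_mod_cast hq
  have hr0 : (0:ℝ) < r := by exact_mod_cast hr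
  set L := φ q * r + φ r * q with hL
  set δ := min (φ q / q) (φ r / r) with hδ
  have hδ0 : 0 < δ := lt_min (by positivity) (by positivity)
  have hL0 : 0 ≤ L := by positivity
  have hsub : eSet k φ q ∩ eSet k φ r ⊆ ⋃ p ∈ closePairs k q r L,
      (Metric.ball (fun i => (p.1 i:ℝ) / q) (φ q / q) ∩ Metric.ball (fun i => (p.2 i:ℝ) / r) (φ r / r)) := by
    rintro y ⟨hy1, hy2⟩
    simp only [eSet, Set.mem_iUnion] at hy1 hy2
    obtain ⟨a, ha, hya⟩ := hy1
    obtain ⟨b, hb, hyb⟩ := hy2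
    simp only [Set.mem_iUnion]
    refine ⟨(a, b), ?_, hya, hyb⟩
    simp only [closePairs, Finset.mem_filter, Finset.mem_product]
    refine ⟨⟨ha, hb⟩, fun i => ?_⟩
    rw [Metric.mem_ball, dist_pi_lt_iff (by positivity)] at hya hyb
    have h1 := hya i
    have h2 := hyb i
    rw [Real.dist_eq] at h1 h2
    have e : (a i:ℝ) * r - (b i:ℝ) * q = ((y i - (b i:ℝ)/r) - (y i - (a i:ℝ)/q)) * (q * r) := by
      field_simp; ring
    rw [e, abs_mul, abs_of_pos (mul_pos hq0 hr0)]
    calc _ ≤ (|y i - (b i:ℝ)/r| + |y i - (a i:ℝ)/q|) * (q * r) :=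
          mul_le_mul_of_nonneg_right (abs_sub _ _) (by positivity)
      _ < (φ r / r + φ q / q) * (q * r) := mul_lt_mul_of_pos_right (by linarith) (by positivity)
      _ = L := by rw [hL]; field_simp; ring
  have hLδ : L * δ ≤ 2 * (φ q * φ r) := by
    have h1 : φ q * r * δ ≤ φ q * r * (φ r / r) := mul_le_mul_of_nonneg_left (min_le_right _ _) (by positivity)
    have h2 : φ r * q * δ ≤ φ r * q * (φ q / q) := mul_le_mul_of_nonneg_left (min_le_left _ _) (by positivity)
    have e1 : φ q * r * (φ r / r) = φ q * φ r := by field_simp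
    have e2 : φ r * q * (φ q / q) = φ q * φ r := by field_simp
    rw [hL, add_mul]; linarith
  have hball : ∀ p : (Fin k → ℕ) × (Fin k → ℕ), volume.real (Metric.ball (fun i => (p.1 i:ℝ) / q) (φ q / q) ∩ Metric.ball (fun i => (p.2 i:ℝ) / r) (φ r / r)) ≤ (2 * δ)^k := by
    intro p
    rcases min_choice (φ q / q) (φ r / r) with h | h
    · rw [hδ, h, ← ball_real_vol k (fun i => (p.1 i:ℝ) / q) _ (by positivity)]
      exact measureReal_mono Set.inter_subset_left measure_ball_lt_top.ne
    · rw [hδ, h, ← ball_real_vol k (fun i => (p.2 i:ℝ) / r) _ (by positivity)]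
      exact measureReal_mono Set.inter_subset_right measure_ball_lt_top.ne
  calc volume.real (eSet k φ q ∩ eSet k φ r) ≤ volume.real (⋃ p ∈ closePairs k q r L,
      (Metric.ball (fun i => (p.1 i:ℝ) / q) (φ q / q) ∩ Metric.ball (fun i => (p.2 i:ℝ) / r) (φ r / r))) := by
        refine measureReal_mono hsub ?_
        refine ((measure_biUnion_lt_top (Finset.finite_toSet _) ?_)).ne
        intro p _
        exact (measure_mono Set.inter_subset_left).trans_lt measure_ball_lt_top
    _ ≤ ∑ p ∈ closePairs k q r L, volume.real (Metric.ball (fun i => (p.1 i:ℝ) / q) (φ q / q) ∩ Metric.ball (fun i => (p.2 i:ℝ) / r) (φ r / r)) := measureReal_biUnion_finset_le _ _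
    _ ≤ ∑ p ∈ closePairs k q r L, (2 * δ)^k := Finset.sum_le_sum (fun p _ => hball p)
    _ = (closePairs k q r L).card * (2 * δ)^k := by simp
    _ ≤ (3 * L)^k * (2 * δ)^k := mul_le_mul_of_nonneg_right (closePairs_card k q r hq hr hqr L hL0) (by positivity)
    _ = (6 * (L * δ))^k := by rw [← mul_pow]; congr 1; ring
    _ ≤ (6 * (2 * (φ q * φ r)))^k := pow_le_pow_left₀ (by positivity) (by linarith) k
    _ = _ := by rw [← mul_pow, ← mul_pow]; congr 1; ring

lemma ks_aux {α : Type*} [MeasurableSpace α] (μ : Measure α) (Q : Finset ℕ) (E : ℕ → Set α)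
    (hm : ∀ q ∈ Q, MeasurableSet (E q)) (hfin : ∀ q ∈ Q, μ (E q) ≠ ⊤) :
    (∑ q ∈ Q, μ.real (E q))^2 ≤ μ.real (⋃ q ∈ Q, E q) *
      ∑ q ∈ Q, ∑ r ∈ Q, μ.real (E q ∩ E r) := by
  set U := ⋃ q ∈ Q, E q with hU
  have hUm : MeasurableSet U := Finset.measurableSet_biUnion _ hm
  have hUf : μ U ≠ ⊤ := (measure_biUnion_lt_top (Finset.finite_toSet _) (fun q hq => (hfin q hq).lt_top)).ne
  set s := ∑ q ∈ Q, μ.real (E q) with hs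
  set D := ∑ q ∈ Q, ∑ r ∈ Q, μ.real (E q ∩ E r) with hD
  have key : ∀ t : ℝ, 0 ≤ D - 2 * t * s + t^2 * μ.real U := by
    intro t
    have hi1 : ∀ q ∈ Q, Integrable ((E q).indicator (fun _ => (1:ℝ))) μ := fun q hq =>
      (integrable_indicator_iff (hm q hq)).2 (integrableOn_const (hfin q hq))
    have hi2 : ∀ q ∈ Q, ∀ r ∈ Q, Integrable ((E q ∩ E r).indicator (fun _ => (1:ℝ))) μ := fun q hq r hr =>
      (integrable_indicator_iff ((hm q hq).inter (hm r hr))).2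
        (integrableOn_const (measure_ne_top_of_subset Set.inter_subset_left (hfin q hq)))
    have hi3 : Integrable (U.indicator (fun _ => (1:ℝ))) μ :=
      (integrable_indicator_iff hUm).2 (integrableOn_const hUf)
    have e : ∫ y, ((∑ q ∈ Q, ∑ r ∈ Q, (E q ∩ E r).indicator (fun _ => (1:ℝ)) y)
        - 2 * t * (∑ q ∈ Q, (E q).indicator (fun _ => (1:ℝ)) y) + t^2 * U.indicator (fun _ => (1:ℝ)) y) ∂μ
        = D - 2 * t * s + t^2 * μ.real U := by
      have j1 : Integrable (fun y => ∑ q ∈ Q, ∑ r ∈ Q, (E q ∩ E r).indicator (fun _ => (1:ℝ)) y) μ :=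
        integrable_finsetSum _ (fun q hq => integrable_finsetSum _ (fun r hr => hi2 q hq r hr))
      have j2 : Integrable (fun y => 2 * t * (∑ q ∈ Q, (E q).indicator (fun _ => (1:ℝ)) y)) μ :=
        (integrable_finsetSum _ (fun q hq => hi1 q hq)).const_mul _
      have j3 : Integrable (fun y => (∑ q ∈ Q, ∑ r ∈ Q, (E q ∩ E r).indicator (fun _ => (1:ℝ)) y)
        - 2 * t * (∑ q ∈ Q, (E q).indicator (fun _ => (1:ℝ)) y)) μ := j1.sub j2
      rw [integral_add j3 (hi3.const_mul _), integral_sub j1 j2, integral_const_mul, integral_const_mul,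
        integral_finsetSum _ (fun q hq => integrable_finsetSum _ (fun r hr => hi2 q hq r hr)),
        integral_finsetSum _ (fun q hq => hi1 q hq), integral_indicator_const _ hUm]
      have hA : ∑ q ∈ Q, ∫ y, ∑ r ∈ Q, (E q ∩ E r).indicator (fun _ => (1:ℝ)) y ∂μ = D := by
        refine Finset.sum_congr rfl (fun q hq => ?_)
        rw [integral_finsetSum _ (fun r hr => hi2 q hq r hr)]
        refine Finset.sum_congr rfl (fun r hr => ?_)
        rw [integral_indicator_const _ ((hm q hq).inter (hm r hr))]; simp
      have hB : ∑ q ∈ Q, ∫ y, (E q).indicator (fun _ => (1:ℝ)) y ∂μ = s := by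
        refine Finset.sum_congr rfl (fun q hq => ?_)
        rw [integral_indicator_const _ (hm q hq)]; simp
      rw [hA, hB, smul_eq_mul, mul_one]
    rw [← e]
    refine integral_nonneg (fun y => ?_)
    have h1 : (∑ q ∈ Q, ∑ r ∈ Q, (E q ∩ E r).indicator (fun _ => (1:ℝ)) y) = (∑ q ∈ Q, (E q).indicator (fun _ => (1:ℝ)) y)^2 := by
      rw [sq, Finset.sum_mul_sum]
      refine Finset.sum_congr rfl (fun q _ => Finset.sum_congr rfl (fun r _ => ?_))
      by_cases h1 : y ∈ E q <;> by_cases h2 : y ∈ E r <;> simp [h1, h2]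
    by_cases hy : y ∈ U
    · simp only [h1, Set.indicator_of_mem hy, Pi.zero_apply]
      nlinarith [sq_nonneg ((∑ q ∈ Q, (E q).indicator (fun _ => (1:ℝ)) y) - t)]
    · have h2 : (∑ q ∈ Q, (E q).indicator (fun _ => (1:ℝ)) y) = 0 := by
        refine Finset.sum_eq_zero (fun q hq => ?_)
        rw [Set.indicator_of_notMem]
        intro h
        exact hy (Set.mem_biUnion (s := (Q : Set ℕ)) hq h)
      simp only [h1, h2, Set.indicator_of_notMem hy, Pi.zero_apply]
      norm_num
  have hU0 : 0 ≤ μ.real U := measureReal_nonneg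
  have hsq := discrim_le_zero (a := μ.real U) (b := -2 * s) (c := D) (fun t => by
    have := key t
    nlinarith)
  rw [discrim] at hsq
  nlinarith

lemma block_lower (k : ℕ) (hk : 2 ≤ k) (φ : ℕ → ℝ) (hφ : ∀ q, 0 < φ q) (hφ2 : ∀ q, φ q ≤ 1/2)
    (Q : Finset ℕ) (hQ : ∀ q ∈ Q, 1 ≤ q) (hs : 1 ≤ ∑ q ∈ Q, (2 * φ q)^k) :
    1 / (16 * (3^k + 1)) ≤ volume.real (⋃ q ∈ Q, eSet k φ q) := by
  set s := ∑ q ∈ Q, (2 * φ q)^k with hsdef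
  have h := ks_aux volume Q (eSet k φ) (fun q _ => eSet_meas k φ q)
    (fun q hq => measure_ne_top_of_subset (eSet_subset k φ q (hQ q hq) (hφ q) (hφ2 q)) measure_closedBall_lt_top.ne)
  have h1 : s / 4 ≤ ∑ q ∈ Q, volume.real (eSet k φ q) := by
    rw [hsdef, Finset.sum_div]
    exact Finset.sum_le_sum (fun q hq => eSet_lower k hk φ q (hQ q hq) (hφ q) (hφ2 q))
  have h2 : ∑ q ∈ Q, ∑ r ∈ Q, volume.real (eSet k φ q ∩ eSet k φ r) ≤ 3^k * s^2 + s := by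
    calc _ ≤ ∑ q ∈ Q, ∑ r ∈ Q, (3^k * ((2 * φ q)^k * (2 * φ r)^k) + if q = r then (2 * φ q)^k else 0) := by
          refine Finset.sum_le_sum (fun q hq => Finset.sum_le_sum (fun r hr => ?_))
          have h0 := hφ q
          have h0' := hφ r
          split_ifs with hqr
          · subst hqr
            rw [Set.inter_self]
            have := eSet_upper k φ q (hQ q hq) h0
            have : 0 ≤ (3:ℝ)^k * ((2 * φ q)^k * (2 * φ q)^k) := by positivity
            linarith
          · rw [add_zero]
            exact eSet_overlap k φ q r (hQ q hq) (hQ r hr) hqr h0 h0'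
      _ = 3^k * s^2 + s := by
          simp_rw [Finset.sum_add_distrib]
          congr 1
          · rw [sq, hsdef, Finset.sum_mul_sum, Finset.mul_sum]
            simp_rw [Finset.mul_sum]
          · rw [hsdef]
            refine Finset.sum_congr rfl (fun q hq => ?_)
            simp [hq]
  set u := volume.real (⋃ q ∈ Q, eSet k φ q) with hu
  have hu0 : 0 ≤ u := measureReal_nonneg
  have h3 : (s/4)^2 ≤ u * (3^k * s^2 + s) := by
    calc (s/4)^2 ≤ (∑ q ∈ Q, volume.real (eSet k φ q))^2 := pow_le_pow_left₀ (by linarith) h1 2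
      _ ≤ _ := h
      _ ≤ _ := mul_le_mul_of_nonneg_left h2 hu0
  have h4 : s ≤ s^2 := by nlinarith
  have h5 : (s/4)^2 ≤ u * ((3^k+1) * s^2) :=
    h3.trans (mul_le_mul_of_nonneg_left (by linarith) hu0)
  rw [div_le_iff₀ (by positivity)]
  have h6 : 0 < s^2 := by positivity
  by_contra hcon
  push Not at hcon
  have := mul_lt_mul_of_pos_right hcon h6
  nlinarith

noncomputable def wSet (k : ℕ) (p : ℕ → Prop) (φ : ℕ → ℝ) : Set (Fin k → ℝ) :=
  {y | ∃ᶠ q : ℕ in atTop, p q ∧ ∃ n : Fin k → ℤ, ∀ i, |(q:ℝ) * y i - n i| < φ q}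

lemma wSet_pos (k : ℕ) (hk : 2 ≤ k) (p : ℕ → Prop) (φ : ℕ → ℝ) (hφ : ∀ q, 0 < φ q)
    (hφ2 : ∀ q, φ q ≤ 1/2)
    (hdiv : ¬ Summable (fun q => if p q then φ q ^ k else 0)) :
    volume (wSet k p φ) ≠ 0 := by
  let F : ℕ → Set (Fin k → ℝ) := fun N => ⋃ q ∈ {q : ℕ | N + 1 ≤ q ∧ p q}, eSet k φ q
  have hanti : Antitone F := by
    intro M N hMN
    refine Set.biUnion_subset_biUnion_left ?_
    intro q hq
    exact ⟨by have := hq.1; omega, hq.2⟩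
  have hsub : ∀ N, F N ⊆ Metric.closedBall 0 2 := by
    intro N
    refine Set.iUnion₂_subset (fun q hq => ?_)
    exact eSet_subset k φ q (by have := hq.1; omega) (hφ q) (hφ2 q)
  have hfin : ∀ N, volume (F N) ≠ ⊤ := fun N =>
    measure_ne_top_of_subset (hsub N) measure_closedBall_lt_top.ne
  have hmeas : ∀ N, MeasurableSet (F N) := fun N =>
    MeasurableSet.biUnion (Set.to_countable _) (fun q _ => eSet_meas k φ q)
  have hlow : ∀ N, ENNReal.ofReal (1 / (16 * (3^k + 1))) ≤ volume (F N) := by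
    intro N
    have h1 : ¬ Summable (fun q => (fun q => if p q then φ q ^ k else 0) (q + (N+1))) := by
      exact fun h => hdiv ((summable_nat_add_iff (f := fun q => if p q then φ q ^ k else 0) (N+1)).1 h)
    rw [not_summable_iff_tendsto_nat_atTop_of_nonneg (fun q => by
      have := hφ (q + (N+1))
      simp only
      split_ifs <;> positivity)] at h1
    obtain ⟨M, hM⟩ := (h1.eventually_ge_atTop 1).exists
    let Q := (Finset.Ico (N+1) (N+1+M)).filter p
    have hQ : ∀ q ∈ Q, N + 1 ≤ q ∧ p q := by
      intro q hq
      have := Finset.mem_filter.1 hq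
      exact ⟨(Finset.mem_Ico.1 this.1).1, this.2⟩
    have hs : 1 ≤ ∑ q ∈ Q, (2 * φ q)^k := by
      refine hM.trans ?_
      have e : ∑ i ∈ Finset.range M, (fun q => if p q then φ q ^ k else 0) (i + (N+1)) = ∑ q ∈ Q, φ q ^ k := by
        rw [Finset.sum_filter, Finset.sum_Ico_eq_sum_range]
        simp [add_comm]
      rw [e]
      refine Finset.sum_le_sum (fun q _ => pow_le_pow_left₀ (hφ q).le ?_ k)
      linarith [hφ q]
    have hb := block_lower k hk φ hφ hφ2 Q (fun q hq => by have := (hQ q hq).1; omega) hs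
    have hQF : (⋃ q ∈ Q, eSet k φ q) ⊆ F N := by
      intro y hy
      simp only [Set.mem_iUnion] at hy
      obtain ⟨q, hq, hy⟩ := hy
      simp only [F, Set.mem_iUnion]
      exact ⟨q, hQ q hq, hy⟩
    calc _ ≤ ENNReal.ofReal (volume.real (⋃ q ∈ Q, eSet k φ q)) := ENNReal.ofReal_le_ofReal hb
      _ ≤ volume (⋃ q ∈ Q, eSet k φ q) := ENNReal.ofReal_toReal_le
      _ ≤ _ := measure_mono hQF
  have hI : ENNReal.ofReal (1 / (16 * (3^k + 1))) ≤ volume (⋂ N, F N) := by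
    rw [hanti.measure_iInter (fun N => (hmeas N).nullMeasurableSet) ⟨0, hfin 0⟩]
    exact le_iInf hlow
  have hIW : (⋂ N, F N) ⊆ wSet k p φ := by
    intro y hy
    simp only [wSet, Set.mem_ofPred_eq]
    rw [frequently_atTop]
    intro N
    have h := Set.mem_iInter.1 hy N
    simp only [F, Set.mem_iUnion] at h
    obtain ⟨q, ⟨hq, hpq⟩, hyq⟩ := h
    refine ⟨q, by omega, hpq, ?_⟩
    simp only [eSet, Set.mem_iUnion] at hyq
    obtain ⟨a, -, hya⟩ := hyq
    have hq0 : (0:ℝ) < q := by exact_mod_cast (by omega : 0 < q)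
    have := hφ q
    rw [Metric.mem_ball, dist_pi_lt_iff (by positivity)] at hya
    refine ⟨fun i => a i, fun i => ?_⟩
    have h1 := hya i
    rw [Real.dist_eq, lt_div_iff₀ hq0, ← abs_of_pos hq0, ← abs_mul, abs_of_pos hq0] at h1
    have e : (q:ℝ) * y i - ((a i : ℤ):ℝ) = (y i - (a i:ℝ)/q) * q := by
      push_cast; field_simp
    rw [e]; exact h1
  intro h0
  have := hI.trans (measure_mono hIW)
  rw [h0] at this
  have h2 : 0 < ENNReal.ofReal (1 / (16 * (3^k + 1))) := ENNReal.ofReal_pos.2 (by positivity)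
  exact absurd this (not_le.2 h2)

lemma mem_blimsup_iff' {α : Type*} (s : ℕ → Set α) (p : ℕ → Prop) (y : α) :
    y ∈ (blimsup s atTop p : Set α) ↔ ∃ᶠ q in atTop, p q ∧ y ∈ s q := by
  rw [blimsup_eq_limsup, mem_limsup_iff_frequently_mem, frequently_inf_principal]
  rfl

lemma wSet_scale (k : ℕ) (p : ℕ → Prop) (hp : ∀ q, p q → 1 ≤ q) (φ : ℕ → ℝ) (hφ : ∀ q, 0 < φ q)
    (hφ2 : ∀ q, φ q ≤ 1/2) (m : ℝ) (hm : 0 < m) :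
    wSet k p (fun q => m * φ q) ≤ᵐ[volume] wSet k p φ := by
  let s : ℕ → Set (Fin k → ℝ) := fun q => {z | ∃ n : Fin k → ℤ, z = fun i => (n i:ℝ) / q}
  let ρ : ℕ → ℝ := fun q => φ q / (2 * q)
  have hρ : Tendsto ρ atTop (nhds 0) := by
    refine squeeze_zero (g := fun q : ℕ => 1 / (q:ℝ)) (fun q => by have := hφ q; positivity) (fun q => ?_)
      tendsto_one_div_atTop_nhds_zero_nat
    rcases Nat.eq_zero_or_pos q with h | h
    · simp [ρ, h]
    · have hq0 : (0:ℝ) < q := by exact_mod_cast h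
      have := hφ2 q
      simp only [ρ]
      rw [div_le_div_iff₀ (by positivity) (by positivity)]
      nlinarith
  have h := blimsup_cthickening_mul_ae_eq (volume : Measure (Fin k → ℝ)) p s (M := 2 * m) (by positivity) ρ hρ
  have hsub1 : wSet k p (fun q => m * φ q) ⊆ (blimsup (fun q => Metric.cthickening (2 * m * ρ q) (s q)) atTop p : Set _) := by
    intro y hy
    rw [mem_blimsup_iff']
    refine Frequently.mono hy ?_
    rintro q ⟨hpq, n, hn⟩
    have hq0 : (0:ℝ) < q := by exact_mod_cast hp q hpq
    refine ⟨hpq, Metric.mem_cthickening_of_dist_le y (fun i => (n i:ℝ)/q) _ _ ⟨n, rfl⟩ ?_⟩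
    have := hφ q
    rw [dist_pi_le_iff (by simp only [ρ]; positivity)]
    intro i
    have h1 := (hn i).le
    rw [Real.dist_eq]
    have e : y i - (n i:ℝ)/q = ((q:ℝ) * y i - n i) / q := by field_simp
    rw [e, abs_div, abs_of_pos hq0, div_le_iff₀ hq0]
    have e2 : 2 * m * ρ q * q = m * φ q := by simp only [ρ]; field_simp
    rw [e2]; exact h1
  have hsub2 : (blimsup (fun q => Metric.cthickening (ρ q) (s q)) atTop p : Set _) ⊆ wSet k p φ := by
    intro y hy
    rw [mem_blimsup_iff'] at hy
    refine Frequently.mono hy ?_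
    rintro q ⟨hpq, hyq⟩
    have hq0 : (0:ℝ) < q := by exact_mod_cast hp q hpq
    have hφq := hφ q
    have hlt : ρ q < φ q / q := by
      simp only [ρ]
      rw [div_lt_div_iff₀ (by positivity) (by positivity)]
      nlinarith [mul_pos hφq hq0]
    have h1 := Metric.cthickening_subset_thickening' (by positivity) hlt _ hyq
    rw [Metric.mem_thickening_iff] at h1
    obtain ⟨z, ⟨n, rfl⟩, hz⟩ := h1
    refine ⟨hpq, n, fun i => ?_⟩
    rw [dist_pi_lt_iff (by positivity)] at hz
    have h2 := hz i
    rw [Real.dist_eq] at h2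
    have e : y i - (n i:ℝ)/q = ((q:ℝ) * y i - n i) / q := by field_simp
    rw [e, abs_div, abs_of_pos hq0, div_lt_div_iff_of_pos_right hq0] at h2
    exact h2
  exact (LE.le.eventuallyLE hsub1).trans (h.le.trans (LE.le.eventuallyLE hsub2))

/-- doubling on the torus -/
noncomputable def dbl (k : ℕ) : UnitAddTorus (Fin k) →+ UnitAddTorus (Fin k) := nsmulAddMonoidHom 2

lemma dbl_iter (k n : ℕ) (t : UnitAddTorus (Fin k)) : (dbl k)^[n] t = (2^n) • t := by
  induction n with
  | zero => simp
  | succ n ih =>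
    rw [Function.iterate_succ_apply', ih, pow_succ', mul_smul]
    rfl

lemma dbl_ergodic (k : ℕ) : Ergodic (dbl k) (volume : Measure (UnitAddTorus (Fin k))) := by
  have : (volume : Measure (UnitAddTorus (Fin k))).IsAddHaarMeasure := by
    infer_instance
  refine AddMonoidHom.ergodic_of_dense_iUnion_preimage_zero (dbl k) ?_ ?_ ?_
  · rw [Metric.dense_iff]
    intro t ε hε
    obtain ⟨n, hn⟩ := exists_pow_lt_of_lt_one hε (show (1/2:ℝ) < 1 by norm_num)
    have ht : ∀ i, ∃ y : ℝ, (y : UnitAddCircle) = t i := fun i => QuotientAddGroup.mk_surjective (t i)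
    choose y hy using ht
    refine ⟨fun i => ((⌊2^n * y i⌋ / 2^n : ℝ) : UnitAddCircle), ?_, ?_⟩
    · rw [Metric.mem_ball, dist_pi_lt_iff hε]
      intro i
      rw [← hy i, dist_eq_norm, ← AddCircle.coe_sub]
      refine lt_of_le_of_lt ?_ hn
      rw [UnitAddCircle.norm_eq]
      refine (round_le _ 0).trans ?_
      rw [Int.cast_zero, sub_zero]
      have h1 := Int.floor_le ((2:ℝ)^n * y i)
      have h2 := Int.lt_floor_add_one ((2:ℝ)^n * y i)
      have e : (⌊2^n * y i⌋ / 2^n : ℝ) - y i = (⌊2^n * y i⌋ - 2^n * y i) / 2^n := by field_simp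
      rw [e, abs_div, abs_of_pos (show (0:ℝ) < 2^n by positivity), div_le_iff₀ (by positivity), ← mul_pow]
      norm_num
      rw [abs_le]; constructor <;> linarith
    · simp only [Set.mem_iUnion]
      refine ⟨n, ?_⟩
      rw [Set.mem_preimage, dbl_iter, Set.mem_zero]
      funext i
      simp only [Pi.smul_apply, Pi.zero_apply]
      rw [← AddCircle.coe_nsmul, AddCircle.coe_eq_zero_iff]
      refine ⟨⌊2^n * y i⌋, ?_⟩
      simp
      field_simp
  · exact continuous_const_smul (2:ℕ)
  · intro t
    have ht : ∀ i, ∃ y : ℝ, (y : UnitAddCircle) = t i := fun i => QuotientAddGroup.mk_surjective (t i)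
    choose y hy using ht
    refine ⟨fun i => ((y i / 2 : ℝ) : UnitAddCircle), ?_⟩
    funext i
    change (2:ℕ) • ((y i / 2 : ℝ) : UnitAddCircle) = t i
    rw [← AddCircle.coe_nsmul, ← hy i]
    congr 1
    simp
    ring

noncomputable def vT (k : ℕ) (p : ℕ → Prop) (φ : ℕ → ℝ) : Set (UnitAddTorus (Fin k)) :=
  ⋃ m : ℕ, blimsup (fun q => {t | ∀ i, ‖q • t i‖ < (m + 1) * φ q}) atTop p

lemma vT_meas (k : ℕ) (p : ℕ → Prop) (φ : ℕ → ℝ) : MeasurableSet (vT k p φ) := by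
  refine MeasurableSet.iUnion (fun m => MeasurableSet.measurableSet_blimsup (fun q _ => ?_))
  have : {t : UnitAddTorus (Fin k) | ∀ i, ‖q • t i‖ < (m + 1) * φ q} = ⋂ i, {t | ‖q • t i‖ < (m + 1) * φ q} := by
    ext t; simp
  rw [this]
  refine MeasurableSet.iInter (fun i => IsOpen.measurableSet ?_)
  exact isOpen_lt (by fun_prop) continuous_const

lemma vT_inv (k : ℕ) (p : ℕ → Prop) (φ : ℕ → ℝ) (hφ : ∀ q, 0 < φ q) :
    vT k p φ ⊆ dbl k ⁻¹' (vT k p φ) := by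
  intro t ht
  simp only [vT, Set.mem_iUnion, Set.mem_preimage, mem_blimsup_iff'] at ht ⊢
  obtain ⟨m, hm⟩ := ht
  refine ⟨2 * m + 1, hm.mono ?_⟩
  rintro q ⟨hpq, h⟩
  refine ⟨hpq, fun i => ?_⟩
  change ‖q • ((2:ℕ) • t i)‖ < _
  rw [smul_comm]
  have h1 := h i
  calc ‖(2:ℕ) • (q • t i)‖ ≤ 2 * ‖q • t i‖ := by
        refine (norm_nsmul_le).trans (by simp)
    _ < 2 * ((m+1) * φ q) := by linarith
    _ = _ := by push_cast; ring

lemma vT_iff (k : ℕ) (p : ℕ → Prop) (φ : ℕ → ℝ) (y : Fin k → ℝ) :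
    (fun i => (y i : UnitAddCircle)) ∈ vT k p φ ↔ ∃ m : ℕ, y ∈ wSet k p (fun q => (m+1) * φ q) := by
  simp only [vT, Set.mem_iUnion, mem_blimsup_iff']
  refine exists_congr (fun m => ?_)
  simp only [wSet, Set.mem_ofPred_eq]
  refine frequently_congr (Eventually.of_forall (fun q => and_congr_right (fun _ => ?_)))
  have e : ∀ i, ‖q • (y i : UnitAddCircle)‖ = |(q:ℝ) * y i - round ((q:ℝ) * y i)| := by
    intro i
    rw [← AddCircle.coe_nsmul, UnitAddCircle.norm_eq, nsmul_eq_mul]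
  constructor
  · intro h
    exact ⟨fun i => round ((q:ℝ) * y i), fun i => by rw [← e i]; exact h i⟩
  · rintro ⟨n, hn⟩ i
    rw [e i]
    exact (round_le _ _).trans_lt (hn i)

lemma torus_null (k : ℕ) (N : Set (UnitAddTorus (Fin k))) (hm : MeasurableSet N) (hN : volume N = 0) :
    ∀ᵐ y : Fin k → ℝ, (fun i => (y i : UnitAddCircle)) ∉ N := by
  have h1 : ∀ a : Fin k → ℤ, ∀ᵐ y : Fin k → ℝ, y ∈ Set.pi Set.univ (fun i => Set.Ioc (a i:ℝ) (a i + 1)) →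
      (fun i => (y i : UnitAddCircle)) ∉ N := by
    intro a
    have hmp := measurePreserving_pi _ _ (fun i => AddCircle.measurePreserving_mk 1 (a i : ℝ))
    rw [← Measure.restrict_pi_pi] at hmp
    rw [← ae_restrict_iff' (MeasurableSet.univ_pi (fun i => measurableSet_Ioc))]
    have h2 := hmp.quasiMeasurePreserving.ae (p := fun t => t ∉ N) (by
      rw [ae_iff]; simpa using! hN)
    exact h2
  rw [← ae_all_iff] at h1
  filter_upwards [h1] with y hy
  refine hy (fun i => ⌈y i⌉ - 1) ?_
  intro i _
  have h1 := Int.le_ceil (y i)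
  have h2 := Int.ceil_lt_add_one (y i)
  simp only [Set.mem_Ioc]
  push_cast
  constructor <;> linarith

theorem gallagher (k : ℕ) (hk : 2 ≤ k) (p : ℕ → Prop) (hp : ∀ q, p q → 1 ≤ q) (φ : ℕ → ℝ)
    (hφ : ∀ q, 0 < φ q) (hφ2 : ∀ q, φ q ≤ 1/2)
    (hdiv : ¬ Summable (fun q => if p q then φ q ^ k else 0)) :
    ∀ᵐ y : Fin k → ℝ, y ∈ wSet k p φ := by
  have hV := (dbl_ergodic k).ae_empty_or_univ_of_ae_le_preimage (vT_meas k p φ).nullMeasurableSet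
    (LE.le.eventuallyLE (vT_inv k p φ hφ))
  have hsc : ∀ᵐ y : Fin k → ℝ, ∀ m : ℕ, y ∈ wSet k p (fun q => ((m:ℝ)+1) * φ q) → y ∈ wSet k p φ := by
    rw [ae_all_iff]
    intro m
    exact wSet_scale k p hp φ hφ hφ2 (m+1) (by positivity)
  rcases hV with h | h
  · exfalso
    apply wSet_pos k hk p φ hφ hφ2 hdiv
    have h1 := torus_null k _ (vT_meas k p φ) (ae_eq_empty.1 h)
    rw [measure_eq_zero_iff_ae_notMem]
    filter_upwards [h1] with y hy hyw
    exact hy ((vT_iff k p φ y).2 ⟨0, by simpa using hyw⟩)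
  · have h1 := torus_null k _ (vT_meas k p φ).compl (ae_eq_univ.1 h)
    filter_upwards [h1, hsc] with y hy hys
    rw [Set.notMem_compl_iff, vT_iff] at hy
    obtain ⟨m, hm⟩ := hy
    exact hys m hm

theorem stmt_5 (l k d : ℕ) (hk : 2 ≤ k) (hd : d = l + k) (x : Fin l → ℝ)
    (ψ : ℕ → ℝ) (hψpos : ∀ q, 0 < ψ q) (hψmono : Antitone ψ)
    (hdiv : ¬ Summable fun q : ℕ => ψ q ^ d) :
    ∀ᵐ y : Fin k → ℝ, ∃ᶠ q : ℕ in atTop,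
      distInt (fun i : Fin (l + k) => (q : ℝ) * Fin.append x y i) < ψ q := by
  let φ : ℕ → ℝ := fun q => min (ψ q) (1/2)
  have hφ : ∀ q, 0 < φ q := fun q => lt_min (hψpos q) (by norm_num)
  have hφ2 : ∀ q, φ q ≤ 1/2 := fun q => min_le_right _ _
  have hφmono : Antitone φ := fun a b hab => min_le_min_right _ (hψmono hab)
  have hdivφ : ¬ Summable (fun q => φ q ^ d) := by
    intro hs
    apply hdiv
    have h1 := hs.tendsto_atTop_zero
    have h2 : ∀ᶠ q in atTop, φ q ^ d < (1/2)^d := h1.eventually_lt_const (by positivity)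
    refine (summable_congr_atTop ?_).1 hs
    filter_upwards [h2] with q hq
    rcases min_choice (ψ q) (1/2) with h | h
    · simp only [φ, h]
    · simp only [φ, h] at hq
      exact absurd hq (lt_irrefl _)
  let p : ℕ → Prop := fun q => 1 ≤ q ∧ ∃ n : Fin l → ℤ, ∀ i, |(q:ℝ) * x i - n i| < φ q
  have hdivp : ¬ Summable (fun q => if p q then φ q ^ k else 0) := by
    intro hs
    apply hdivφ
    have hs1 := (summable_nat_add_iff (f := fun q => if p q then φ q ^ k else 0) 1).2 hs
    rw [← summable_nat_add_iff (f := fun q => φ q ^ d) 1]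
    let a : ℕ → ℝ := fun q => if ∃ n : Fin l → ℤ, ∀ i, |(q:ℝ) * x i - n i| < φ q then 1 else 0
    have hA : ∀ N : ℕ, (1/2)^l * N * φ N ^ l - 1 ≤ ∑ q ∈ Finset.range N, a (q+1) := by
      intro N
      refine (pigeon_aux l x (φ N) (hφ N) ((hφ2 N).trans (by norm_num)) N).trans ?_
      refine Finset.sum_le_sum (fun q hq => ?_)
      have hqN : φ N ≤ φ (q+1) := hφmono (Finset.mem_range.1 hq)
      simp only [a]
      split_ifs with h1 h2 h2
      · exact le_rfl
      · obtain ⟨n, hn⟩ := h1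
        exact absurd ⟨n, fun i => (hn i).trans_le hqN⟩ h2
      · norm_num
      · exact le_rfl
    have hP := partial_sum_aux k l (by omega) φ hφ hφmono a ((1/2)^l) (by positivity) hA
    have hc : (0:ℝ) < (1/2)^l / (l+1) := by positivity
    refine summable_of_sum_range_le (c := ((∑' q, (if p (q+1) then φ (q+1) ^ k else 0)) + φ 0 ^ k) / ((1/2)^l / (l+1)))
      (fun q => pow_nonneg (hφ _).le _) (fun N => ?_)
    rw [le_div_iff₀ hc, mul_comm]
    have h1 := hP N
    have h2 : ∑ q ∈ Finset.range N, a (q+1) * φ (q+1) ^ k ≤ ∑' q, (if p (q+1) then φ (q+1) ^ k else 0) := by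
      have e : ∀ q, a (q+1) * φ (q+1)^k = if p (q+1) then φ (q+1) ^ k else 0 := by
        intro q
        have hpq : p (q+1) ↔ ∃ n : Fin l → ℤ, ∀ i, |((q+1 : ℕ):ℝ) * x i - n i| < φ (q+1) :=
          ⟨fun h => h.2, fun h => ⟨by omega, h⟩⟩
        simp only [a, hpq]
        split_ifs <;> simp
      simp_rw [e]
      refine hs1.sum_le_tsum _ (fun q _ => ?_)
      have := hφ (q+1)
      split_ifs <;> positivity
    subst hd
    linarith
  filter_upwards [gallagher k hk p (fun q h => h.1) φ hφ hφ2 (by convert hdivp)] with y hy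
  refine Frequently.mono hy ?_
  rintro q ⟨⟨-, n, hn⟩, n', hn'⟩
  have hle : φ q ≤ ψ q := min_le_left _ _
  refine lt_of_le_of_lt (ciInf_le ⟨0, ?_⟩ (Fin.append n n')) ?_
  · rintro _ ⟨m, rfl⟩
    exact norm_nonneg _
  · rw [pi_norm_lt_iff (hψpos q)]
    intro i
    rw [Real.norm_eq_abs]
    refine Fin.addCases (fun j => ?_) (fun j => ?_) i
    · simp only [Pi.sub_apply, Fin.append_left]
      exact (hn j).trans_le hle
    · simp only [Pi.sub_apply, Fin.append_right]
      exact (hn' j).trans_le hle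
end

section
/- Fix x ∈ R^ℓ and τ > τ_D(x), where τ_D(x) is the dual Diophantine type of x. Then there exists N_0 such that for all N ≥ N_0 and all δ with N^{−1/τ} ≤ δ, the number of positive integers q ≤ N with ‖qx‖ < δ is at most 4^{ℓ+1}·N·δ^ℓ. -/
open scoped Classical ENNReal

/-- Distance from `t ∈ ℝ` to the nearest integer. -/
noncomputable def distZ (t : ℝ) : ℝ := ⨅ p : ℤ, |t - (p : ℝ)|

/-- The dual Diophantine type of `x ∈ ℝ^ℓ`, valued in `ℝ≥0∞`. -/
noncomputable def tauD {l : ℕ} (x : Fin l → ℝ) : ℝ≥0∞ :=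
  ⨆ τ ∈ {τ : ℝ | 0 < τ ∧
    {n : Fin l → ℤ | n ≠ 0 ∧
      distZ (∑ i, (n i : ℝ) * x i) < ‖fun i => ((n i : ℝ))‖ ^ (-τ)}.Infinite},
    ENNReal.ofReal τ


open Real

noncomputable def ee (t : ℝ) : ℂ := Complex.exp (Complex.I * ((2 * π * t : ℝ) : ℂ))

lemma ee_add (s t : ℝ) : ee (s + t) = ee s * ee t := by
  unfold ee; rw [← Complex.exp_add]; congr 1; push_cast; ring

lemma ee_zero : ee 0 = 1 := by simp [ee]

lemma norm_ee (t : ℝ) : ‖ee t‖ = 1 := by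
  unfold ee; rw [mul_comm]; exact Complex.norm_exp_ofReal_mul_I _

lemma ee_int (n : ℤ) : ee (n : ℝ) = 1 := by
  unfold ee; rw [Complex.exp_eq_one_iff]; exact ⟨n, by push_cast; ring⟩

lemma ee_nat_mul (k : ℕ) (t : ℝ) : ee (k * t) = ee t ^ k := by
  unfold ee; rw [← Complex.exp_nat_mul]; congr 1; push_cast; ring

lemma ee_conj (t : ℝ) : (starRingEnd ℂ) (ee t) = ee (-t) := by
  unfold ee; rw [← Complex.exp_conj]; congr 1
  rw [map_mul, Complex.conj_I, Complex.conj_ofReal]; push_cast; ring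

lemma ee_sum {α : Type*} (s : Finset α) (f : α → ℝ) : ee (∑ i ∈ s, f i) = ∏ i ∈ s, ee (f i) := by
  classical
  induction s using Finset.induction_on with
  | empty => simp [ee_zero]
  | insert a s h ih => rw [Finset.sum_insert h, Finset.prod_insert h, ee_add, ih]

lemma norm_ee_sub_one (t : ℝ) : ‖ee t - 1‖ = 2 * |sin (π * t)| := by
  unfold ee
  rw [Complex.norm_exp_I_mul_ofReal_sub_one, norm_mul, Real.norm_eq_abs, Real.norm_eq_abs]
  rw [show 2 * π * t / 2 = π * t by ring]; norm_num

noncomputable def DD (K : ℕ) (y : ℝ) : ℂ := ∑ k ∈ Finset.range K, ee (k * y)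

lemma DD_mul (K : ℕ) (y : ℝ) : ‖DD K y‖ * |sin (π * y)| = |sin (π * (K * y))| := by
  have h : DD K y * (ee y - 1) = ee (K * y) - 1 := by
    unfold DD; simp_rw [ee_nat_mul]; exact geom_sum_mul _ _
  have := congrArg norm h
  rw [norm_mul, norm_ee_sub_one, norm_ee_sub_one] at this
  linarith

lemma DD_sq (K : ℕ) (y : ℝ) : ((‖DD K y‖ ^ 2 : ℝ) : ℂ) =
    ∑ a ∈ Finset.range K, ∑ b ∈ Finset.range K, ee (((a : ℝ) - b) * y) := by
  rw [Complex.ofReal_pow, ← Complex.mul_conj']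
  unfold DD
  rw [map_sum, Finset.sum_mul_sum]
  refine Finset.sum_congr rfl fun a _ => Finset.sum_congr rfl fun b _ => ?_
  rw [ee_conj, ← ee_add]; congr 1; ring

lemma DD_lower (K : ℕ) (y : ℝ) : |sin (π * (K * y))| ≤ ‖DD K y‖ * (π * |y|) := by
  rw [← DD_mul]
  gcongr
  calc |sin (π * y)| ≤ |π * y| := Real.abs_sin_le_abs
    _ = _ := by rw [abs_mul, abs_of_pos pi_pos]

lemma DD_lower_near (K : ℕ) (y : ℝ) (hy : K * |y| ≤ 2/5) : 0.735 * K ≤ ‖DD K y‖ := by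
  rcases eq_or_ne y 0 with rfl | h0
  · simp [DD, ee_zero]; have : (0:ℝ) ≤ K := by positivity
    linarith
  have h := DD_lower K y
  have hpos : 0 < |y| := abs_pos.mpr h0
  set z := |y| with hz
  have h1 : |sin (π * (K * y))| = |sin (π * (K * z))| := by
    rcases abs_choice y with h | h
    · rw [hz, h]
    · rw [hz, h]; simp
  rw [h1] at h
  have hu0 : 0 ≤ π * (K * z) := by positivity
  have h2 : π * (K * z) - (π * (K * z)) ^ 3 / 6 ≤ sin (π * (K * z)) := Real.sin_ge_sub_cube hu0
  have h3 := le_abs_self (sin (π * (K * z)))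
  have hpi : π < 3.15 := pi_lt_d2
  have hu : π * (K * z) ≤ 1.26 := by
    calc π * (K * z) ≤ 3.15 * (2/5) := by gcongr
      _ = _ := by norm_num
  have h5 : 0.735 * (π * (K * z)) ≤ ‖DD K y‖ * (π * z) := by
    have : (π * (K * z)) ^ 2 ≤ 1.26 ^ 2 := by gcongr
    nlinarith
  have h6 : 0 < π * z := by positivity
  by_contra! hc
  nlinarith

lemma DD_two (K : ℕ) (hK : 0 < K) (y : ℝ) (h0 : 0 ≤ y) (h1 : K * y ≤ 1) :
    0.54 * (K:ℝ) ^ 2 ≤ ‖DD K y‖ ^ 2 + ‖DD K (y - 1 / K)‖ ^ 2 := by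
  have hK' : (0:ℝ) < K := by exact_mod_cast hK
  by_cases c1 : K * y ≤ 2/5
  · have := DD_lower_near K y (by rwa [abs_of_nonneg h0])
    have h2 : (0.735 * K) ^ 2 ≤ ‖DD K y‖ ^ 2 := by gcongr
    nlinarith [sq_nonneg ‖DD K (y - 1 / K)‖]
  have e1 : K * (y - 1 / K) = K * y - 1 := by field_simp
  have hneg : y - 1 / K ≤ 0 := by
    by_contra! hc
    have := mul_pos hK' hc
    linarith
  have e2 : K * |y - 1 / K| = 1 - K * y := by
    rw [abs_of_nonpos hneg]; linarith
  by_cases c2 : 3/5 ≤ K * y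
  · have := DD_lower_near K (y - 1 / K) (by rw [e2]; linarith)
    have h2 : (0.735 * K) ^ 2 ≤ ‖DD K (y - 1 / K)‖ ^ 2 := by gcongr
    nlinarith [sq_nonneg ‖DD K y‖]
  push Not at c1 c2
  have l1 := DD_lower K y
  have l2 := DD_lower K (y - 1 / K)
  rw [abs_of_nonneg h0] at l1
  rw [e1] at l2
  set a := K * y with ha
  have hs : sin (π * (a - 1)) = - sin (π * a) := by
    rw [mul_sub, mul_one, Real.sin_sub_pi]
  rw [hs, abs_neg] at l2
  have hpi : π < 3.15 := pi_lt_d2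
  have hpi0 := pi_pos
  have hsl : 0.95 ≤ sin (π * a) := by
    rw [← Real.cos_sub_pi_div_two]
    have := Real.one_sub_sq_div_two_le_cos (x := π * a - π / 2)
    have h7 : |π * a - π / 2| ≤ 0.315 := by
      rw [show π * a - π / 2 = π * (a - 1/2) by ring, abs_mul, abs_of_pos hpi0]
      have : |a - 1/2| ≤ 1/10 := by rw [abs_le]; constructor <;> linarith
      calc π * |a - 1/2| ≤ 3.15 * (1/10) := by gcongr
        _ = _ := by norm_num
    have h8 : (π * a - π / 2) ^ 2 ≤ 0.315 ^ 2 := by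
      rw [← sq_abs]; gcongr
    linarith
  have hsl' := le_abs_self (sin (π * a))
  have m1 : 0.95 * K ≤ ‖DD K y‖ * (3.15 * a) := by
    calc 0.95 * K ≤ (‖DD K y‖ * (π * y)) * K := by gcongr; linarith
      _ = ‖DD K y‖ * (π * a) := by rw [ha]; ring
      _ ≤ _ := by gcongr
  have m2 : 0.95 * K ≤ ‖DD K (y - 1 / K)‖ * (3.15 * (1 - a)) := by
    calc 0.95 * K ≤ (‖DD K (y - 1 / K)‖ * (π * |y - 1 / K|)) * K := by gcongr; linarith
      _ = ‖DD K (y - 1 / K)‖ * (π * (1 - a)) := by rw [← e2]; ring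
      _ ≤ _ := by gcongr
  generalize ‖DD K (y - 1 / K)‖ = B at *
  generalize ‖DD K y‖ = A at *
  -- A ≥ 0.3 K / a, B ≥ 0.3 K/(1-a)
  have n1 : 0.3 * K ≤ A * a := by linarith
  have n2 : 0.3 * K ≤ B * (1 - a) := by linarith
  have n3 : 1.2 * K ≤ A + B := by
    have A1 : 0.3 * K * a⁻¹ ≤ A := by
      rw [← div_eq_mul_inv, div_le_iff₀ (by linarith)]; exact n1
    have B1 : 0.3 * K * (1 - a)⁻¹ ≤ B := by
      rw [← div_eq_mul_inv, div_le_iff₀ (by linarith)]; exact n2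
    have : 4 ≤ a⁻¹ + (1 - a)⁻¹ := by
      have p1 : 0 < a := by linarith
      have p2 : 0 < 1 - a := by linarith
      rw [show a⁻¹ + (1 - a)⁻¹ = 1 / (a * (1 - a)) by field_simp; ring, le_div_iff₀ (by positivity)]
      nlinarith [sq_nonneg (a - 1/2)]
    nlinarith
  nlinarith [sq_nonneg (A - B)]

lemma distZ_eq (t : ℝ) : distZ t = |t - round t| := by
  unfold distZ
  apply le_antisymm
  · exact ciInf_le ⟨0, by rintro _ ⟨p, rfl⟩; positivity⟩ (round t)
  · exact le_ciInf fun p => round_le t p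

lemma DD_upper (H : ℕ) (t : ℝ) : ‖DD H (-t)‖ * (2 * distZ t) ≤ 1 := by
  have h := DD_mul H (-t)
  have h1 : 2 * distZ t ≤ |sin (π * (-t))| := by
    rw [mul_neg, Real.sin_neg, abs_neg, distZ_eq]
    have e : |sin (π * t)| = |sin (π * (t - round t))| := by
      rw [mul_sub, mul_comm π (round t : ℝ), Real.sin_sub_int_mul_pi, abs_mul, abs_zpow]
      simp
    rw [e]
    have hr := abs_sub_round t
    have hp := pi_pos
    have := Real.mul_abs_le_abs_sin (x := π * (t - round t)) (by
      rw [abs_mul, abs_of_pos hp]; nlinarith)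
    rw [abs_mul, abs_of_pos hp] at this
    calc 2 * |t - round t| = 2 / π * (π * |t - round t|) := by field_simp
      _ ≤ _ := this
  calc _ ≤ ‖DD H (-t)‖ * |sin (π * (-t))| := by gcongr
    _ ≤ 1 := by rw [h]; exact Real.abs_sin_le_one _

lemma smooth (N m H : ℕ) (F : ℤ → ℝ) (hF : ∀ q, 0 ≤ F q) :
    (H : ℝ) ^ m * ∑ q ∈ Finset.Icc 1 N, F (q : ℤ) ≤
      ∑ a : Fin m → Fin H, ∑ b ∈ Finset.Icc 1 (N + m * H), F ((b : ℤ) - ∑ i, ((a i : ℕ) : ℤ)) := by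
  have key : ∀ a : Fin m → Fin H, ∑ q ∈ Finset.Icc 1 N, F (q : ℤ) ≤
      ∑ b ∈ Finset.Icc 1 (N + m * H), F ((b : ℤ) - ∑ i, ((a i : ℕ) : ℤ)) := by
    intro a
    have hs : ∑ i, (a i : ℕ) ≤ m * H := by
      calc ∑ i, (a i : ℕ) ≤ ∑ i : Fin m, H := Finset.sum_le_sum fun i _ => (a i).2.le
        _ = _ := by simp
    set s := ∑ i, (a i : ℕ) with hs'
    have e : ∑ i, ((a i : ℕ) : ℤ) = (s : ℤ) := by rw [hs']; push_cast; rfl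
    rw [e]
    calc ∑ q ∈ Finset.Icc 1 N, F (q : ℤ)
        = ∑ b ∈ (Finset.Icc 1 N).image (fun q => q + s), F ((b : ℤ) - s) := by
          rw [Finset.sum_image (fun x _ y _ h => by simpa using h)]
          refine Finset.sum_congr rfl fun q _ => ?_
          congr 1; push_cast; ring
      _ ≤ _ := by
          apply Finset.sum_le_sum_of_subset_of_nonneg
          · intro b hb
            simp only [Finset.mem_image, Finset.mem_Icc] at hb ⊢
            obtain ⟨q, hq, rfl⟩ := hb
            constructor <;> omega
          · intro b _ _; exact hF _
  calc _ = ∑ a : Fin m → Fin H, ∑ q ∈ Finset.Icc 1 N, F (q : ℤ) := by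
        rw [Finset.sum_const]; simp
    _ ≤ _ := Finset.sum_le_sum fun a _ => key a

lemma smooth_ee (M m H : ℕ) (t : ℝ) :
    ∑ a : Fin m → Fin H, ∑ b ∈ Finset.Icc 1 M, ee ((((b : ℤ) - ∑ i, ((a i : ℕ) : ℤ) : ℤ) : ℝ) * t)
     = (∑ b ∈ Finset.Icc 1 M, ee (b * t)) * DD H (-t) ^ m := by
  have : DD H (-t) = ∑ a : Fin H, ee ((a : ℕ) * (-t)) := by
    unfold DD; rw [Finset.sum_range]
  rw [this, Fintype.sum_pow, Finset.mul_sum]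
  refine Finset.sum_congr rfl fun a _ => ?_
  rw [Finset.sum_mul]
  refine Finset.sum_congr rfl fun b _ => ?_
  rw [← ee_sum, ← ee_add]
  congr 1
  push_cast
  rw [← Finset.sum_mul]; ring

lemma main_bound {ι : Type*} [Fintype ι] (l N m H : ℕ) (hH : 0 < H) (x : Fin l → ℝ)
    (k : ι → ℤ) (c : ι → ℂ) (G : ℝ → ℝ) (hG0 : ∀ y, 0 ≤ G y)
    (hG : ∀ y, (G y : ℂ) = ∑ i, c i * ee (k i * y)) (η : ℝ) (hη0 : 0 ≤ η)
    (hη : ∀ ν : Fin l → ι, (∃ i, k (ν i) ≠ 0) →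
      ‖DD H (-(∑ i, (k (ν i) : ℝ) * x i))‖ ^ m ≤ η * H ^ m) :
    ∑ q ∈ Finset.Icc 1 N, ∏ i, G (q * x i) ≤
      (N + m * H : ℝ) * ((∑ i, if k i = 0 then ‖c i‖ else 0) ^ l + η * (∑ i, ‖c i‖) ^ l) := by
  set F : ℤ → ℝ := fun q => ∏ i, G (q * x i) with hFdef
  have hF0 : ∀ q, 0 ≤ F q := fun q => Finset.prod_nonneg fun i _ => hG0 _
  have hs := smooth N m H F hF0
  set θ : (Fin l → ι) → ℝ := fun ν => ∑ i, (k (ν i) : ℝ) * x i with hθ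
  have hFe : ∀ q : ℤ, (F q : ℂ) = ∑ ν : Fin l → ι, (∏ i, c (ν i)) * ee (q * θ ν) := by
    intro q
    simp only [hFdef]
    push_cast
    simp_rw [hG]
    rw [Finset.prod_univ_sum, Fintype.piFinset_univ]
    refine Finset.sum_congr rfl fun ν _ => ?_
    rw [Finset.prod_mul_distrib, ← ee_sum]
    congr 2
    rw [hθ, Finset.mul_sum]
    refine Finset.sum_congr rfl fun i _ => ?_
    ring
  set R := ∑ a : Fin m → Fin H, ∑ b ∈ Finset.Icc 1 (N + m * H),
    F ((b : ℤ) - ∑ i, ((a i : ℕ) : ℤ)) with hR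
  have hRe : (R : ℂ) = ∑ ν : Fin l → ι, (∏ i, c (ν i)) *
      ((∑ b ∈ Finset.Icc 1 (N + m * H), ee (b * θ ν)) * DD H (-θ ν) ^ m) := by
    rw [hR]
    push_cast
    simp_rw [hFe, ← smooth_ee, Finset.mul_sum]
    rw [Finset.sum_comm (s := (Finset.univ : Finset (Fin l → ι)))]
    refine Finset.sum_congr rfl fun a _ => ?_
    rw [Finset.sum_comm]
  have hb : ∀ ν, ‖(∏ i, c (ν i)) *
      ((∑ b ∈ Finset.Icc 1 (N + m * H), ee (b * θ ν)) * DD H (-θ ν) ^ m)‖ ≤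
      (N + m * H : ℝ) * H ^ m * ((∏ i, if k (ν i) = 0 then ‖c (ν i)‖ else 0) + η * ∏ i, ‖c (ν i)‖) := by
    intro ν
    rw [norm_mul, norm_mul, norm_prod, norm_pow]
    have h1 : ‖∑ b ∈ Finset.Icc 1 (N + m * H), ee (b * θ ν)‖ ≤ (N + m * H : ℝ) := by
      refine (norm_sum_le _ _).trans ?_
      simp [norm_ee]
    have hP : 0 ≤ ∏ i, ‖c (ν i)‖ := Finset.prod_nonneg fun i _ => norm_nonneg _
    by_cases hz : ∃ i, k (ν i) ≠ 0
    · have h2 := hη ν hz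
      have h3 : (0:ℝ) ≤ ∏ i, if k (ν i) = 0 then ‖c (ν i)‖ else 0 :=
        Finset.prod_nonneg fun i _ => by split_ifs <;> positivity
      calc _ ≤ (∏ i, ‖c (ν i)‖) * ((N + m * H : ℝ) * (η * H ^ m)) := by gcongr
        _ = (N + m * H : ℝ) * H ^ m * (0 + η * ∏ i, ‖c (ν i)‖) := by ring
        _ ≤ _ := by gcongr
    · push Not at hz
      have h3 : (∏ i, if k (ν i) = 0 then ‖c (ν i)‖ else 0) = ∏ i, ‖c (ν i)‖ :=
        Finset.prod_congr rfl fun i _ => by rw [if_pos (hz i)]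
      have h4 : ‖DD H (-θ ν)‖ ≤ H := by
        unfold DD
        refine (norm_sum_le _ _).trans ?_
        simp [norm_ee]
      rw [h3]
      calc _ ≤ (∏ i, ‖c (ν i)‖) * ((N + m * H : ℝ) * H ^ m) := by gcongr
        _ = (N + m * H : ℝ) * H ^ m * (∏ i, ‖c (ν i)‖ + 0) := by ring
        _ ≤ _ := by gcongr; positivity
  have hRle : R ≤ (N + m * H : ℝ) * H ^ m *
      ((∑ i, if k i = 0 then ‖c i‖ else 0) ^ l + η * (∑ i, ‖c i‖) ^ l) := by
    calc R ≤ ‖(R : ℂ)‖ := by rw [Complex.norm_real]; exact le_abs_self R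
      _ ≤ _ := by
        rw [hRe]
        refine (norm_sum_le _ _).trans ((Finset.sum_le_sum fun ν _ => hb ν).trans ?_)
        rw [← Finset.mul_sum, Finset.sum_add_distrib, ← Finset.mul_sum, Fintype.sum_pow,
          Fintype.sum_pow]
  have hHm : (0:ℝ) < (H:ℝ) ^ m := by positivity
  have := hs.trans hRle
  have e : ∑ q ∈ Finset.Icc 1 N, ∏ i, G (q * x i) = ∑ q ∈ Finset.Icc 1 N, F (q : ℤ) := by
    simp [hFdef]
  rw [e]
  refine le_of_mul_le_mul_left (this.trans (le_of_eq ?_)) hHm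
  ring

lemma DD_sub_int (K : ℕ) (y : ℝ) (p : ℤ) : DD K (y - p) = DD K y := by
  unfold DD
  refine Finset.sum_congr rfl fun k _ => ?_
  rw [show (k:ℝ) * (y - p) = k * y + ((-(k * p) : ℤ) : ℝ) by push_cast; ring, ee_add, ee_int, mul_one]

lemma majorant (δ : ℝ) (h0 : 0 < δ) (h1 : δ ≤ 1) : ∃ (ι : Type) (_ : Fintype ι) (k : ι → ℤ)
    (c : ι → ℂ) (G : ℝ → ℝ), (∀ y, 0 ≤ G y) ∧ (∀ y, (G y : ℂ) = ∑ i, c i * ee (k i * y)) ∧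
    (∀ i, |(k i : ℝ)| ≤ 21 / δ) ∧ (∑ i, if k i = 0 then ‖c i‖ else 0) ≤ 4 * δ ∧
    (∑ i, ‖c i‖) ≤ 84 ∧ ∀ (y : ℝ) (p : ℤ), |y - p| < δ → 1 ≤ G y := by
  obtain ⟨K, hK⟩ : ∃ K : ℕ, K = ⌈20 / δ⌉₊ := ⟨_, rfl⟩
  have hK1 : 20 / δ ≤ K := hK ▸ Nat.le_ceil _
  have hK2 : (K:ℝ) ≤ 21 / δ := by
    have := Nat.ceil_lt_add_one (show 0 ≤ 20 / δ by positivity)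
    rw [← hK] at this
    have : 1 ≤ 1 / δ := by rw [le_div_iff₀ h0]; linarith
    have e : 21 / δ = 20 / δ + 1 / δ := by ring
    linarith
  have hKpos : (0:ℝ) < K := lt_of_lt_of_le (by positivity) hK1
  have hKn : 0 < K := by exact_mod_cast hKpos
  have hKδ : 20 ≤ K * δ := by rwa [div_le_iff₀ h0] at hK1
  have hKδ2 : K * δ ≤ 21 := by rwa [le_div_iff₀ h0] at hK2
  obtain ⟨J, hJ⟩ : ∃ J : ℕ, J = ⌈K * δ⌉₊ := ⟨_, rfl⟩
  have hJ1 : K * δ ≤ J := hJ ▸ Nat.le_ceil _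
  have hJ2 : (J:ℝ) ≤ K * δ + 1 := by
    have := Nat.ceil_lt_add_one (show 0 ≤ K * δ by positivity)
    rw [← hJ] at this; exact this.le
  set lam : ℝ := 1 / (0.54 * K ^ 2) with hlam
  have hlpos : 0 < lam := by positivity
  have hc : ∀ i : Fin K × Fin K × Fin (2 * J + 1), ‖(lam : ℂ) * ee (((i.1 : ℕ) - (i.2.1 : ℕ) : ℝ) *
      -((((i.2.2 : ℕ) : ℝ) - J) / K))‖ = lam := by
    intro i
    rw [norm_mul, norm_ee, Complex.norm_real, Real.norm_of_nonneg hlpos.le, mul_one]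
  refine ⟨Fin K × Fin K × Fin (2 * J + 1), inferInstance,
    fun i => (i.1 : ℤ) - (i.2.1 : ℤ),
    fun i => (lam : ℂ) * ee (((i.1 : ℕ) - (i.2.1 : ℕ) : ℝ) * -((((i.2.2 : ℕ) : ℝ) - J) / K)),
    fun y => lam * ∑ j : Fin (2 * J + 1), ‖DD K (y - (((j : ℕ) : ℝ) - J) / K)‖ ^ 2,
    ?_, ?_, ?_, ?_, ?_, ?_⟩
  · intro y; positivity
  · intro y
    rw [Complex.ofReal_mul, Complex.ofReal_sum]
    simp_rw [DD_sq, Finset.sum_range]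
    rw [Fintype.sum_prod_type]
    simp_rw [Fintype.sum_prod_type]
    rw [Finset.sum_comm, Finset.mul_sum]
    refine Finset.sum_congr rfl fun a _ => ?_
    rw [Finset.sum_comm, Finset.mul_sum]
    refine Finset.sum_congr rfl fun b _ => ?_
    rw [Finset.mul_sum]
    refine Finset.sum_congr rfl fun j _ => ?_
    rw [mul_assoc, ← ee_add]
    congr 2
    push_cast; ring
  · intro i
    refine le_trans ?_ hK2
    have h1 : ((i.1 : ℕ) : ℝ) ≤ K := by exact_mod_cast i.1.2.le
    have h2 : ((i.2.1 : ℕ) : ℝ) ≤ K := by exact_mod_cast i.2.1.2.le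
    have h3 : (0:ℝ) ≤ ((i.1 : ℕ) : ℝ) := by positivity
    have h4 : (0:ℝ) ≤ ((i.2.1 : ℕ) : ℝ) := by positivity
    push_cast
    rw [abs_le]; constructor <;> linarith
  · simp_rw [hc]
    rw [Fintype.sum_prod_type]
    simp_rw [Fintype.sum_prod_type]
    have : ∀ a : Fin K, ∑ b : Fin K, ∑ j : Fin (2 * J + 1),
        (if ((a : ℕ) : ℤ) - ((b : ℕ) : ℤ) = 0 then lam else 0) = (2 * J + 1) * lam := by
      intro a
      rw [Finset.sum_eq_single a]
      · simp
      · intro b _ hb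
        have : ((a : ℕ) : ℤ) - ((b : ℕ) : ℤ) ≠ 0 := by
          intro h; apply hb; ext; omega
        simp [this]
      · simp
    simp_rw [this]
    rw [Finset.sum_const, Finset.card_univ, Fintype.card_fin, nsmul_eq_mul, hlam]
    rw [show (K:ℝ) * ((2 * J + 1) * (1 / (0.54 * K ^ 2))) = (2 * J + 1) / (0.54 * K) by field_simp]
    rw [div_le_iff₀ (by positivity)]
    nlinarith
  · simp_rw [hc]
    rw [Finset.sum_const, Finset.card_univ, Fintype.card_prod, Fintype.card_prod, Fintype.card_fin,
      Fintype.card_fin, nsmul_eq_mul, hlam]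
    push_cast
    rw [show (K:ℝ) * (K * (2 * J + 1)) * (1 / (0.54 * K ^ 2)) = (2 * J + 1) / 0.54 by field_simp]
    rw [div_le_iff₀ (by norm_num)]
    nlinarith
  · intro y p hy
    set r : ℤ := ⌊K * (y - p)⌋ with hr
    have hr1 : (r:ℝ) ≤ K * (y - p) := Int.floor_le _
    have hr2 : K * (y - p) < r + 1 := Int.lt_floor_add_one _
    have hyl := abs_lt.mp hy
    have hJu : K * (y - p) < J := lt_of_lt_of_le (by nlinarith) hJ1
    have hJl : -(J:ℝ) < K * (y - p) := by nlinarith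
    have hrJ : r < J := by
      have : (r:ℝ) < J := by linarith
      exact_mod_cast this
    have hrJ' : -(J:ℤ) ≤ r := by
      have : -(J:ℝ) < r + 1 := by linarith
      have : -(J:ℤ) < r + 1 := by exact_mod_cast this
      omega
    obtain ⟨s, hs⟩ : ∃ s : ℕ, (s:ℤ) = r + J := ⟨(r + J).toNat, by omega⟩
    have hsr : (s:ℝ) = r + J := by exact_mod_cast hs
    let j1 : Fin (2 * J + 1) := ⟨s, by omega⟩
    let j2 : Fin (2 * J + 1) := ⟨s + 1, by omega⟩
    have hne : j1 ≠ j2 := by intro h; simp [j1, j2] at h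
    have h2 := DD_two K hKn (y - p - r / K) (by
        have : (r:ℝ) / K ≤ y - p := by rw [div_le_iff₀ hKpos]; linarith
        linarith) (by
        rw [mul_sub, mul_div_cancel₀ _ hKpos.ne']; linarith)
    have e1 : DD K (y - ((((j1 : Fin (2 * J + 1)) : ℕ) : ℝ) - J) / K) = DD K (y - p - r / K) := by
      rw [← DD_sub_int K _ p]; congr 1
      simp only [j1, hsr]; ring
    have e2 : DD K (y - ((((j2 : Fin (2 * J + 1)) : ℕ) : ℝ) - J) / K) =
        DD K (y - p - r / K - 1 / K) := by
      rw [← DD_sub_int K _ p]; congr 1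
      simp only [j2]; push_cast; rw [hsr]; ring
    have h3 : 0.54 * (K:ℝ) ^ 2 ≤
        ∑ j : Fin (2 * J + 1), ‖DD K (y - (((j : ℕ) : ℝ) - J) / K)‖ ^ 2 := by
      refine h2.trans ?_
      rw [← e1, ← e2, ← Finset.sum_pair (f := fun j : Fin (2 * J + 1) =>
        ‖DD K (y - (((j : ℕ) : ℝ) - J) / K)‖ ^ 2) hne]
      exact Finset.sum_le_univ_sum_of_nonneg fun j => by positivity
    calc (1:ℝ) = lam * (0.54 * K ^ 2) := by rw [hlam]; field_simp
      _ ≤ _ := mul_le_mul_of_nonneg_left h3 hlpos.le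

lemma distZ_nonneg (t : ℝ) : 0 ≤ distZ t := by rw [distZ_eq]; positivity

lemma dio {l : ℕ} (x : Fin l → ℝ) (τ : ℝ)
    (hfin : {n : Fin l → ℤ | n ≠ 0 ∧
      distZ (∑ i, (n i : ℝ) * x i) < ‖fun i => ((n i : ℝ))‖ ^ (-τ)}.Finite) :
    ∃ c : ℝ, 0 < c ∧ ∀ n : Fin l → ℤ, n ≠ 0 →
      c * ‖fun i => ((n i : ℝ))‖ ^ (-τ) ≤ distZ (∑ i, (n i : ℝ) * x i) := by
  have hnorm : ∀ n : Fin l → ℤ, n ≠ 0 → 0 < ‖fun i => ((n i : ℝ))‖ := by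
    intro n hn
    rw [norm_pos_iff]
    intro h
    apply hn
    ext i
    have := congrFun h i
    simpa using this
  have hpos : ∀ n : Fin l → ℤ, n ≠ 0 → 0 < distZ (∑ i, (n i : ℝ) * x i) := by
    intro n hn
    refine lt_of_le_of_ne (distZ_nonneg _) fun h0 => ?_
    rw [eq_comm, distZ_eq, abs_eq_zero, sub_eq_zero] at h0
    set p := round (∑ i, (n i : ℝ) * x i)
    have hinj : Function.Injective (fun k : ℕ => fun i => ((k:ℤ) + 1) * n i) := by
      intro a b hab
      obtain ⟨i, hi⟩ := Function.ne_iff.mp hn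
      have := congrFun hab i
      simp only at this
      have := mul_right_cancel₀ hi this
      omega
    refine Set.infinite_of_injective_forall_mem hinj (fun k => ?_) hfin
    have hne : (fun i => ((k:ℤ) + 1) * n i) ≠ 0 := by
      obtain ⟨i, hi⟩ := Function.ne_iff.mp hn
      intro h
      have := congrFun h i
      simp only [Pi.zero_apply, mul_eq_zero] at this
      rcases this with h | h
      · omega
      · exact hi h
    refine ⟨hne, ?_⟩
    have e : ∑ i, (((((k:ℤ) + 1) * n i : ℤ)) : ℝ) * x i = (((k:ℤ) + 1) * p : ℤ) := by
      push_cast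
      rw [← h0, Finset.mul_sum]
      refine Finset.sum_congr rfl fun i _ => by ring
    rw [e, distZ_eq, round_intCast, sub_self, abs_zero]
    exact Real.rpow_pos_of_pos (hnorm _ hne) _
  set S := hfin.toFinset with hS
  have hrp : ∀ n : Fin l → ℤ, n ≠ 0 → 0 < ‖fun i => ((n i : ℝ))‖ ^ (-τ) := fun n hn =>
    Real.rpow_pos_of_pos (hnorm _ hn) _
  rcases S.eq_empty_or_nonempty with he | hne
  · refine ⟨1, one_pos, fun n hn => ?_⟩
    by_contra! hc
    rw [one_mul] at hc
    have : n ∈ S := by rw [hS, Set.Finite.mem_toFinset]; exact ⟨hn, hc⟩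
    rw [he] at this; simp at this
  · obtain ⟨n0, hn0, hmin⟩ := S.exists_min_image
      (fun n => distZ (∑ i, (n i : ℝ) * x i) / ‖fun i => ((n i : ℝ))‖ ^ (-τ)) hne
    have hn00 : n0 ≠ 0 := by
      rw [hS, Set.Finite.mem_toFinset] at hn0; exact hn0.1
    refine ⟨min 1 (distZ (∑ i, (n0 i : ℝ) * x i) / ‖fun i => ((n0 i : ℝ))‖ ^ (-τ)),
      lt_min one_pos (div_pos (hpos _ hn00) (hrp _ hn00)), fun n hn => ?_⟩
    by_cases hc : distZ (∑ i, (n i : ℝ) * x i) < ‖fun i => ((n i : ℝ))‖ ^ (-τ)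
    · have : n ∈ S := by rw [hS, Set.Finite.mem_toFinset]; exact ⟨hn, hc⟩
      rw [← le_div_iff₀ (hrp _ hn)]
      exact (min_le_right _ _).trans (hmin n this)
    · push Not at hc
      refine le_trans ?_ hc
      have := hrp n hn
      nlinarith [min_le_left 1 (distZ (∑ i, (n0 i : ℝ) * x i) / ‖fun i => ((n0 i : ℝ))‖ ^ (-τ))]

lemma exists_type {l : ℕ} (x : Fin l → ℝ) (τ : ℝ) (hτ : tauD x < ENNReal.ofReal τ) :
    ∃ τ' : ℝ, 0 < τ' ∧ τ' < τ ∧ {n : Fin l → ℤ | n ≠ 0 ∧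
      distZ (∑ i, (n i : ℝ) * x i) < ‖fun i => ((n i : ℝ))‖ ^ (-τ')}.Finite := by
  obtain ⟨t, ht0, ht1, ht2⟩ := ENNReal.lt_iff_exists_real_btwn.mp hτ
  have htpos : 0 < t := by
    by_contra! h
    rw [ENNReal.ofReal_of_nonpos h] at ht1
    exact not_lt_zero ht1
  have htt : t < τ := (ENNReal.ofReal_lt_ofReal_iff_of_nonneg ht0).mp ht2
  refine ⟨t, htpos, htt, ?_⟩
  by_contra hinf
  have : ENNReal.ofReal t ≤ tauD x := by
    unfold tauD
    exact le_iSup₂ (f := fun (τ : ℝ) (_ : τ ∈ {τ : ℝ | 0 < τ ∧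
    {n : Fin l → ℤ | n ≠ 0 ∧
      distZ (∑ i, (n i : ℝ) * x i) < ‖fun i => ((n i : ℝ))‖ ^ (-τ)}.Infinite}) =>
        ENNReal.ofReal τ) t ⟨htpos, hinf⟩
  exact absurd ht1 (not_lt.mpr this)

theorem stmt_12 (l : ℕ) (x : Fin l → ℝ) (τ : ℝ) (hτ : tauD x < ENNReal.ofReal τ) :
    ∃ N₀ : ℕ, ∀ N : ℕ, N₀ ≤ N → ∀ δ : ℝ, (N : ℝ) ^ (-(1 / τ)) ≤ δ →
      (((Finset.Icc 1 N).filter fun q : ℕ =>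
          distInt (fun i => (q : ℝ) * x i) < δ).card : ℝ) ≤
        4 ^ (l + 1) * N * δ ^ l := by
  obtain ⟨σ, hσ0, hσ, hfin⟩ := exists_type x τ hτ
  obtain ⟨c, hc0, hc⟩ := dio x σ hfin
  have hτ0 : 0 < τ := hσ0.trans hσ
  set ρ := σ / τ with hρ
  have hρ1 : ρ < 1 := by rw [hρ, div_lt_one hτ0]; exact hσ
  obtain ⟨m, hm⟩ : ∃ m : ℕ, (l / τ) / (1 - ρ) < m := exists_nat_gt _
  have hm0' : (0:ℝ) < m := lt_of_le_of_lt (by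
    have : 0 < 1 - ρ := by linarith
    positivity) hm
  have hm0 : 0 < m := by exact_mod_cast hm0'
  rw [div_lt_iff₀ (by linarith)] at hm
  set A : ℝ := m * 21 ^ σ / c with hA
  have hA0 : 0 < A := by positivity
  have hlim : Filter.Tendsto (fun N : ℕ => 21 ^ l * A ^ m * (N:ℝ) ^ (-(m * (1 - ρ) - l / τ)))
      Filter.atTop (nhds (21 ^ l * A ^ m * 0)) :=
    ((tendsto_rpow_neg_atTop (by linarith)).comp tendsto_natCast_atTop_atTop).const_mul _
  rw [mul_zero] at hlim
  obtain ⟨N₁, hN₁⟩ := Filter.eventually_atTop.mp (hlim.eventually_le_const one_pos)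
  refine ⟨max N₁ m, fun N hN δ hδ => ?_⟩
  have hNm : m ≤ N := (le_max_right _ _).trans hN
  have hNpos : (0:ℝ) < N := by exact_mod_cast lt_of_lt_of_le hm0 hNm
  have hlarge := hN₁ N ((le_max_left _ _).trans hN)
  have hδ0 : 0 < δ := lt_of_lt_of_le (Real.rpow_pos_of_pos hNpos _) hδ
  by_cases hδ1 : 1 < δ
  · have h1 : (((Finset.Icc 1 N).filter fun q : ℕ =>
          distInt (fun i => (q : ℝ) * x i) < δ).card : ℝ) ≤ N := by
      have := Finset.card_filter_le (Finset.Icc 1 N) (fun q : ℕ =>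
          distInt (fun i => (q : ℝ) * x i) < δ)
      rw [Nat.card_Icc, Nat.add_sub_cancel] at this
      exact_mod_cast this
    have h2 : (1:ℝ) ≤ δ ^ l := one_le_pow₀ hδ1.le
    have h3 : (1:ℝ) ≤ 4 ^ (l + 1) := one_le_pow₀ (by norm_num)
    calc _ ≤ 1 * (N:ℝ) * 1 := by linarith
      _ ≤ _ := by gcongr
  push Not at hδ1
  obtain ⟨ι, _, k, cc, G, hG0, hG, hk, hz, hT, hG1⟩ := majorant δ hδ0 hδ1
  set H := N / m with hH
  have hHpos : 0 < H := Nat.div_pos hNm hm0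
  have hmH : m * H ≤ N := Nat.mul_div_le N m
  have hmH2 : N ≤ 2 * (m * H) := by
    have : N < m * (H + 1) := Nat.lt_mul_div_succ N hm0
    nlinarith
  have hmHr : (m:ℝ) * H ≤ N := by exact_mod_cast hmH
  have hmH2r : (N:ℝ) ≤ 2 * (m * H) := by exact_mod_cast hmH2
  have hδinv : 1 / δ ≤ (N:ℝ) ^ (1 / τ) := by
    rw [div_le_iff₀ hδ0]
    calc (1:ℝ) = (N:ℝ) ^ (1 / τ) * (N:ℝ) ^ (-(1 / τ)) := by
          rw [← Real.rpow_add hNpos]; simp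
      _ ≤ _ := by gcongr
  set η : ℝ := (A * (N:ℝ) ^ (-(1 - ρ))) ^ m with hη
  have hη0 : 0 ≤ η := by positivity
  have hkey := main_bound l N m H hHpos x k cc G hG0 hG η hη0 (by
    rintro ν ⟨i0, hi0⟩
    rw [hη, ← mul_pow]
    gcongr
    have hn : (fun i => k (ν i)) ≠ 0 := fun h => hi0 (congrFun h i0)
    have hd := hc _ hn
    have hnle : ‖fun i => ((k (ν i) : ℤ) : ℝ)‖ ≤ 21 * (N:ℝ) ^ (1 / τ) := by
      rw [pi_norm_le_iff_of_nonneg (by positivity)]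
      intro i
      rw [Real.norm_eq_abs]
      refine (hk _).trans ?_
      rw [show 21 / δ = 21 * (1 / δ) by ring]
      gcongr
    have hnpos : 0 < ‖fun i => ((k (ν i) : ℤ) : ℝ)‖ := by
      rw [norm_pos_iff]
      intro h
      have := congrFun h i0
      simp only [Pi.zero_apply, Int.cast_eq_zero] at this
      exact hi0 this
    have hd2 : c * ((21:ℝ) ^ (-σ) * (N:ℝ) ^ (-ρ)) ≤ distZ (∑ i, (k (ν i) : ℝ) * x i) := by
      refine le_trans ?_ hd
      gcongr
      calc (21:ℝ) ^ (-σ) * (N:ℝ) ^ (-ρ) = (21 * (N:ℝ) ^ (1 / τ)) ^ (-σ) := by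
            rw [Real.mul_rpow (by norm_num) (by positivity), ← Real.rpow_mul hNpos.le]
            congr 2; rw [hρ]; ring
        _ ≤ _ := Real.rpow_le_rpow_of_nonpos hnpos hnle (by linarith)
    have hu := DD_upper H (∑ i, (k (ν i) : ℝ) * x i)
    set d := c * ((21:ℝ) ^ (-σ) * (N:ℝ) ^ (-ρ)) with hdd
    have hdpos : 0 < d := by positivity
    have hu2 : ‖DD H (-(∑ i, (k (ν i) : ℝ) * x i))‖ * (2 * d) ≤ 1 := by
      refine le_trans ?_ hu
      gcongr
    have hAd : A * (N:ℝ) ^ (-(1 - ρ)) * H * (2 * d) = 2 * (m * H) / N := by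
      have e1 : (N:ℝ) ^ (-(1 - ρ)) * (N:ℝ) ^ (-ρ) = 1 / N := by
        rw [← Real.rpow_add hNpos, show -(1 - ρ) + -ρ = -1 by ring, Real.rpow_neg_one, one_div]
      have e2 : (21:ℝ) ^ σ * (21:ℝ) ^ (-σ) = 1 := by
        rw [← Real.rpow_add (by norm_num)]; simp
      calc A * (N:ℝ) ^ (-(1 - ρ)) * H * (2 * d)
          = 2 * (m * H) * ((21:ℝ) ^ σ * (21:ℝ) ^ (-σ)) * ((N:ℝ) ^ (-(1 - ρ)) * (N:ℝ) ^ (-ρ))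
              * (c / c) := by rw [hA, hdd]; ring
        _ = _ := by rw [e1, e2, div_self hc0.ne']; ring
    have hge : 1 ≤ A * (N:ℝ) ^ (-(1 - ρ)) * H * (2 * d) := by
      rw [hAd, le_div_iff₀ hNpos]; linarith
    exact le_of_mul_le_mul_right (hu2.trans hge) (by positivity : 0 < 2 * d))
  have hcount : (((Finset.Icc 1 N).filter fun q : ℕ =>
          distInt (fun i => (q : ℝ) * x i) < δ).card : ℝ) ≤
      ∑ q ∈ Finset.Icc 1 N, ∏ i, G (q * x i) := by
    rw [Finset.card_filter]
    push_cast
    refine Finset.sum_le_sum fun q _ => ?_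
    split_ifs with hq
    · obtain ⟨p, hp⟩ := exists_lt_of_ciInf_lt hq
      have : ∀ i, 1 ≤ G (q * x i) := fun i => hG1 _ (p i) (by
        have := (norm_le_pi_norm ((fun i => (q : ℝ) * x i) - fun i => (p i : ℝ)) i).trans_lt hp
        simpa using this)
      calc (1:ℝ) = ∏ i : Fin l, (1:ℝ) := by simp
        _ ≤ _ := Finset.prod_le_prod (fun i _ => zero_le_one) fun i _ => this i
    · exact Finset.prod_nonneg fun i _ => hG0 _
  have hη1 : η * 84 ^ l ≤ (4 * δ) ^ l := by
    have h1 : η * 21 ^ l ≤ δ ^ l := by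
      calc η * 21 ^ l = (21 ^ l * A ^ m * (N:ℝ) ^ (-(m * (1 - ρ) - l / τ))) *
              ((N:ℝ) ^ (-(1 / τ))) ^ l := by
            rw [hη, mul_pow, ← Real.rpow_mul_natCast hNpos.le, ← Real.rpow_mul_natCast hNpos.le,
              mul_assoc _ _ ((N:ℝ) ^ (-(1 / τ) * l)), ← Real.rpow_add hNpos,
              show -(m * (1 - ρ) - l / τ) + -(1 / τ) * l = -(1 - ρ) * m by ring]
            ring
        _ ≤ 1 * δ ^ l := by gcongr
        _ = _ := one_mul _
    calc η * 84 ^ l = 4 ^ l * (η * 21 ^ l) := by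
          rw [show (84:ℝ) = 4 * 21 by norm_num, mul_pow]; ring
      _ ≤ 4 ^ l * δ ^ l := by gcongr
      _ = _ := by rw [mul_pow]
  have hz0 : (0:ℝ) ≤ ∑ i, if k i = 0 then ‖cc i‖ else 0 :=
    Finset.sum_nonneg fun i _ => by split_ifs <;> positivity
  calc _ ≤ _ := hcount
    _ ≤ _ := hkey
    _ ≤ (N + N : ℝ) * ((4 * δ) ^ l + (4 * δ) ^ l) := by
      gcongr
      exact le_trans (by gcongr) hη1
    _ = _ := by rw [mul_pow]; ring
end

section
/- Let x ∈ R^{d−1} with dual Diophantine type τ_D(x) < d, and let ψ : N → R^+ be such that for every ε > 0, ψ(q) ≥ q^{−1/d−ε} for all sufficiently large q. Then for any integers k ≥ 2 and ℓ, there exists a constant C > 0 and j_0 such that for all j ≥ j_0, #{0 < q ≤ k^{j+ℓ} : ‖qx‖ < ψ(k^j)} ≤ C · k^{j+ℓ} · ψ(k^j)^{d−1}. -/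
open scoped Classical ENNReal
open Filter

open MeasureTheory in
lemma aux_re (s : UnitAddCircle) (h : ‖s‖ ≤ 1/6) : 1/2 ≤ ((AddCircle.toCircle s : Circle) : ℂ).re := by
  induction s using QuotientAddGroup.induction_on with
  | H r =>
  rw [UnitAddCircle.norm_eq] at h
  have h1 := fourier_coe_apply' (T := 1) (n := 1) (x := r)
  rw [one_zsmul] at h1
  rw [h1]
  have h2 : (2 * Real.pi * Complex.I * ((1:ℤ):ℂ) * r / ((1:ℝ):ℂ)) = ((2 * Real.pi * r : ℝ) : ℂ) * Complex.I := by
    push_cast; ring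
  rw [h2, Complex.exp_ofReal_mul_I_re]
  have h3 : Real.cos (2 * Real.pi * r) = Real.cos |2 * Real.pi * (r - round r)| := by
    rw [Real.cos_abs, ← Real.cos_sub_int_mul_two_pi _ (round r)]
    congr 1; ring
  rw [h3, ← Real.cos_pi_div_three]
  have hp := Real.pi_pos
  apply Real.cos_le_cos_of_nonneg_of_le_pi (abs_nonneg _) (by linarith)
  rw [abs_mul, abs_of_pos (by positivity)]
  nlinarith

open MeasureTheory in
lemma aux_parseval (S : Finset ℕ) :
    ∫ t : UnitAddCircle, ‖∑ q ∈ S, (fourier (q:ℤ) t : ℂ)‖^2 ∂volume = S.card := by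
  have ho := @orthonormal_fourier 1 _
  have ho' : Orthonormal ℂ (fun q : ℕ => @fourierLp 1 _ 2 _ (q:ℤ)) := ho.comp _ Nat.cast_injective
  have h1 := ho'.inner_sum (fun _ => (1:ℂ)) (fun _ => (1:ℂ)) S
  simp only [one_smul, map_one, mul_one, Finset.sum_const, nsmul_eq_mul] at h1
  have h2 : ∑ q ∈ S, (@fourierLp 1 _ 2 _ (q:ℤ)) = ContinuousMap.toLp (E := ℂ) 2 (@AddCircle.haarAddCircle 1 _) ℂ (∑ q ∈ S, fourier (q:ℤ)) := by
    rw [map_sum]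
  rw [h2, ContinuousMap.inner_toLp] at h1
  have h3 : (volume : Measure UnitAddCircle) = AddCircle.haarAddCircle := by
    have := @AddCircle.volume_eq_smul_haarAddCircle 1 _
    rw [ENNReal.ofReal_one, one_smul] at this
    exact this
  rw [h3]
  apply Complex.ofReal_injective
  rw [← integral_complex_ofReal, Complex.ofReal_natCast, ← h1]
  congr 1
  ext t
  rw [Complex.mul_conj, Complex.normSq_eq_norm_sq]
  simp

open MeasureTheory in
lemma aux_core (S : Finset ℕ) (E : Set UnitAddCircle) (hE : MeasurableSet E)
    (h : ∀ t ∈ E, ∀ q ∈ S, ‖q • t‖ ≤ 1/6) : (volume E).toReal * S.card ≤ 4 := by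
  rcases S.eq_empty_or_nonempty with rfl | hS
  · simp
  have hc : (0:ℝ) < S.card := by exact_mod_cast hS.card_pos
  have hf : Continuous (fun t : UnitAddCircle => ‖∑ q ∈ S, (fourier (q:ℤ) t : ℂ)‖^2) := by fun_prop
  have hi : Integrable (fun t : UnitAddCircle => ‖∑ q ∈ S, (fourier (q:ℤ) t : ℂ)‖^2) volume :=
    hf.integrable_of_hasCompactSupport (HasCompactSupport.of_compactSpace _)
  have h1 : ∫ t in E, ((S.card:ℝ)/2)^2 ≤ ∫ t in E, ‖∑ q ∈ S, (fourier (q:ℤ) t : ℂ)‖^2 := by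
    apply setIntegral_mono_on (integrable_const _) hi.integrableOn hE
    intro t ht
    gcongr
    refine le_trans ?_ (Complex.re_le_norm _)
    rw [Complex.re_sum]
    have : ∑ q ∈ S, (1/2:ℝ) ≤ ∑ q ∈ S, (fourier (q:ℤ) t : ℂ).re := by
      apply Finset.sum_le_sum
      intro q hq
      rw [fourier_apply]
      apply aux_re
      rw [natCast_zsmul]
      exact h t ht q hq
    simp only [Finset.sum_const, nsmul_eq_mul] at this
    linarith
  have h2 : ∫ t in E, ‖∑ q ∈ S, (fourier (q:ℤ) t : ℂ)‖^2 ≤ S.card := by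
    rw [← aux_parseval S]
    exact setIntegral_le_integral hi (Filter.Eventually.of_forall fun t => by positivity)
  rw [setIntegral_const, smul_eq_mul, Measure.real] at h1
  have := h1.trans h2
  by_contra hh
  push Not at hh
  nlinarith

lemma aux_norm_le (t : ℝ) (p : ℤ) : ‖(t : UnitAddCircle)‖ ≤ |t - p| := by
  rw [UnitAddCircle.norm_eq]; exact round_le t p

lemma aux_distZ (t : ℝ) : distZ t ≤ ‖(t : UnitAddCircle)‖ := by
  rw [UnitAddCircle.norm_eq]
  exact ciInf_le ⟨0, by rintro _ ⟨p, rfl⟩; exact abs_nonneg _⟩ (round t)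

lemma aux_distInt {l : ℕ} (y : Fin l → ℝ) (δ : ℝ) (h : distInt y < δ) (i : Fin l) :
    ‖(y i : UnitAddCircle)‖ ≤ δ := by
  obtain ⟨p, hp⟩ := exists_lt_of_ciInf_lt h
  refine (aux_norm_le (y i) (p i)).trans (le_trans ?_ hp.le)
  exact norm_le_pi_norm (y - fun i => (p i : ℝ)) i

/-- the point `⟨n,x⟩` mod 1 -/
noncomputable def alph {l : ℕ} (x : Fin l → ℝ) (n : Fin l → ℤ) : UnitAddCircle :=
  ((∑ i, (n i : ℝ) * x i : ℝ) : UnitAddCircle)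

lemma alph_eq {l : ℕ} (x : Fin l → ℝ) (n : Fin l → ℤ) :
    alph x n = ∑ i, n i • (x i : UnitAddCircle) := by
  unfold alph
  have : ∀ y : Fin l → ℝ, ((∑ i, y i : ℝ) : UnitAddCircle) = ∑ i, (y i : UnitAddCircle) := fun y =>
    map_sum (QuotientAddGroup.mk' (AddSubgroup.zmultiples (1:ℝ))) y Finset.univ
  rw [this]
  refine Finset.sum_congr rfl fun i _ => ?_
  rw [← zsmul_eq_mul]; rfl

/-- Diophantine condition from the type. -/
lemma aux_dioph {l d : ℕ} (hd : 0 < d) (x : Fin l → ℝ) (htype : tauD x < (d : ℝ≥0∞)) :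
    ∃ τ : ℝ, 0 < τ ∧ τ < d ∧ ∃ c : ℝ, 0 < c ∧ ∀ n : Fin l → ℤ, n ≠ 0 →
      c * ‖fun i => ((n i : ℝ))‖ ^ (-τ) ≤ ‖alph x n‖ := by
  obtain ⟨r, hr1, hr2⟩ := ENNReal.lt_iff_exists_real_btwn.1 htype |>.imp fun r h => h.2
  have hr0 : 0 < r := ENNReal.ofReal_pos.1 (lt_of_le_of_lt zero_le hr1)
  have hrd : r < d := by
    rw [← ENNReal.ofReal_natCast] at hr2
    exact (ENNReal.ofReal_lt_ofReal_iff (by exact_mod_cast hd)).1 hr2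
  refine ⟨r, hr0, hrd, ?_⟩
  set B : Set (Fin l → ℤ) := {n : Fin l → ℤ | n ≠ 0 ∧
      distZ (∑ i, (n i : ℝ) * x i) < ‖fun i => ((n i : ℝ))‖ ^ (-r)} with hB
  have hfin : B.Finite := by
    by_contra hinf
    have : ENNReal.ofReal r ≤ tauD x := by
      unfold tauD
      exact le_iSup₂_of_le r ⟨hr0, hinf⟩ le_rfl
    exact absurd hr1 (not_lt.2 this)
  have hnpos : ∀ n : Fin l → ℤ, n ≠ 0 → 0 < ‖fun i => ((n i : ℝ))‖ := by
    intro n hn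
    rw [norm_pos_iff]
    intro h0
    apply hn
    ext i
    have := congrFun h0 i
    simpa using this
  have hpos : ∀ n : Fin l → ℤ, n ≠ 0 → 0 < ‖alph x n‖ := by
    intro n hn
    by_contra h0
    have h0' : alph x n = 0 := by
      rw [← norm_eq_zero]; exact le_antisymm (not_lt.1 h0) (norm_nonneg _)
    have hinj : Function.Injective (fun m : ℕ => ((m:ℤ)+1) • n) := by
      intro a b hab
      obtain ⟨i, hi⟩ := Function.ne_iff.1 hn
      have := congrFun hab i
      simp only [Pi.smul_apply, smul_eq_mul] at this
      have := mul_right_cancel₀ hi this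
      omega
    refine Set.infinite_of_injective_forall_mem hinj (s := B) ?_ hfin
    intro m
    have hmn : ((m:ℤ)+1) • n ≠ 0 := smul_ne_zero (by omega) hn
    refine ⟨hmn, ?_⟩
    refine lt_of_le_of_lt (aux_distZ _) ?_
    change ‖alph x _‖ < _
    have : alph x (((m:ℤ)+1) • n) = ((m:ℤ)+1) • alph x n := by
      simp only [alph_eq, Finset.smul_sum, smul_smul, Pi.smul_apply, smul_eq_mul]
    rw [this, h0', smul_zero, norm_zero]
    exact Real.rpow_pos_of_pos (hnpos _ hmn) _
  have hex : ∃ c : ℝ, 0 < c ∧ ∀ n ∈ hfin.toFinset, c * ‖fun i => ((n i : ℝ))‖ ^ (-r) ≤ ‖alph x n‖ := by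
    have : ∀ F : Finset (Fin l → ℤ), (∀ n ∈ F, n ≠ 0) → ∃ c : ℝ, 0 < c ∧ ∀ n ∈ F, c * ‖fun i => ((n i : ℝ))‖ ^ (-r) ≤ ‖alph x n‖ := by
      intro F
      induction F using Finset.induction_on with
      | empty => intro _; exact ⟨1, one_pos, by simp⟩
      | insert a s ha ih =>
        intro h
        obtain ⟨c, hc, hcs⟩ := ih fun n hn => h n (Finset.mem_insert_of_mem hn)
        have ha0 := h a (Finset.mem_insert_self _ _)
        have hp := Real.rpow_pos_of_pos (hnpos a ha0) (-r)
        refine ⟨min c (‖alph x a‖ / ‖fun i => ((a i : ℝ))‖ ^ (-r)), lt_min hc (div_pos (hpos a ha0) hp), ?_⟩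
        intro n hn
        rcases Finset.mem_insert.1 hn with rfl | hn
        · rw [← le_div_iff₀ hp]; exact min_le_right _ _
        · exact le_trans (mul_le_mul_of_nonneg_right (min_le_left _ _) (by positivity)) (hcs n hn)
    apply this
    intro n hn
    exact ((Set.Finite.mem_toFinset hfin).1 hn).1
  obtain ⟨c, hc, hcB⟩ := hex
  refine ⟨min c 1, lt_min hc one_pos, fun n hn => ?_⟩
  by_cases hnB : n ∈ B
  · exact le_trans (mul_le_mul_of_nonneg_right (min_le_left _ _) (by positivity)) (hcB n ((Set.Finite.mem_toFinset hfin).2 hnB))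
  · have : ‖fun i => ((n i : ℝ))‖ ^ (-r) ≤ distZ (∑ i, (n i : ℝ) * x i) := by
      by_contra hh
      exact hnB ⟨hn, not_le.1 hh⟩
    refine le_trans (mul_le_mul_of_nonneg_right (min_le_right _ _) (by positivity)) ?_
    rw [one_mul]
    exact this.trans (aux_distZ _)

open MeasureTheory in
lemma aux_count {l : ℕ} (hl : 0 < l) (x : Fin l → ℝ) (τ c : ℝ) (hτ : 0 < τ) (hc : 0 < c)
    (hdio : ∀ n : Fin l → ℤ, n ≠ 0 → c * ‖fun i => ((n i : ℝ))‖ ^ (-τ) ≤ ‖alph x n‖) :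
    ∃ C : ℝ, 0 < C ∧ ∀ (N δ : ℝ), 1 ≤ N → 0 < δ → N⁻¹ ≤ δ ^ τ → 
      (((Finset.Icc 1 (Nat.floor N)).filter fun q : ℕ =>
          distInt (fun i => (q : ℝ) * x i) < δ).card : ℝ) ≤ C * N * δ ^ l := by
  set w0 : ℝ := min (1/12) (c/3) with hw0
  have hw0p : 0 < w0 := lt_min (by norm_num) (by positivity)
  refine ⟨4 / (2 * w0) * (12 * l) ^ l, by positivity, ?_⟩
  intro N δ hN hδ hNδ
  set S := ((Finset.Icc 1 (Nat.floor N)).filter fun q : ℕ =>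
          distInt (fun i => (q : ℝ) * x i) < δ) with hS
  have hN0 : 0 < N := by linarith
  set w := w0 / N with hw
  have hwp : 0 < w := by positivity
  have hlR : (1:ℝ) ≤ l := by exact_mod_cast hl
  set M : ℕ := ⌊1 / (12 * l * δ)⌋₊ with hM
  have hMle : (M:ℝ) ≤ 1 / (12 * l * δ) := Nat.floor_le (by positivity)
  have hMlt : 1 / (12 * l * δ) < (M:ℝ) + 1 := Nat.lt_floor_add_one _
  let T : Finset (Fin l → ℤ) := Fintype.piFinset fun _ => Finset.Icc (0:ℤ) M
  have hTcard : T.card = (M+1)^l := by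
    simp [T, Fintype.card_piFinset]
  have hTmem : ∀ n ∈ T, ∀ i, 0 ≤ n i ∧ n i ≤ M := by
    intro n hn i
    exact Finset.mem_Icc.1 (Fintype.mem_piFinset.1 hn i)
  -- separation
  have hsep : ∀ n ∈ T, ∀ m ∈ T, n ≠ m → 3 * w ≤ ‖alph x n - alph x m‖ := by
    intro n hn m hm hnm
    have h0 : n - m ≠ 0 := sub_ne_zero.2 hnm
    have h1 : alph x n - alph x m = alph x (n - m) := by
      simp [alph_eq, sub_smul]
    rw [h1]
    refine le_trans ?_ (hdio _ h0)
    have hnorm : ‖fun i => (((n-m) i : ℤ) : ℝ)‖ ≤ M := by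
      rw [pi_norm_le_iff_of_nonneg (by positivity)]
      intro i
      have h1 := hTmem n hn i
      have h2 := hTmem m hm i
      rw [Real.norm_eq_abs, ← Int.cast_abs]
      have : |(n-m) i| ≤ (M:ℤ) := by
        rw [Pi.sub_apply, abs_le]; constructor <;> omega
      exact_mod_cast this
    have hnorm0 : 0 < ‖fun i => (((n-m) i : ℤ) : ℝ)‖ := by
      rw [norm_pos_iff]
      intro h
      apply h0
      ext i
      have := congrFun h i
      exact Int.cast_eq_zero.1 this
    have hle : ‖fun i => (((n-m) i : ℤ) : ℝ)‖ ≤ δ⁻¹ := by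
      refine hnorm.trans (hMle.trans ?_)
      rw [one_div]
      apply inv_anti₀ hδ
      nlinarith
    have h2 : δ ^ τ ≤ ‖fun i => (((n-m) i : ℤ) : ℝ)‖ ^ (-τ) := by
      have := Real.rpow_le_rpow_of_nonpos hnorm0 hle (z := -τ) (by linarith)
      rwa [Real.inv_rpow hδ.le, Real.rpow_neg hδ.le, inv_inv] at this
    calc 3 * w ≤ c * N⁻¹ := by
          rw [hw, div_eq_mul_inv, ← mul_assoc]
          gcongr
          have := min_le_right (1/12:ℝ) (c/3)
          linarith
      _ ≤ _ := by gcongr; exact hNδ.trans h2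
  set E : Set UnitAddCircle := ⋃ n ∈ T, Metric.closedBall (alph x n) w with hEdef
  have hEm : MeasurableSet E := Finset.measurableSet_biUnion _ fun n _ => Metric.isClosed_closedBall.measurableSet
  have hvol : (volume E) = ENNReal.ofReal ((M+1)^l * (2*w)) := by
    rw [hEdef, measure_biUnion_finset]
    · simp only [AddCircle.volume_closedBall]
      have : min 1 (2*w) = 2 * w := by
        apply min_eq_right
        have h1 := min_le_left (1/12:ℝ) (c/3)
        have h2 : w ≤ w0 := div_le_self hw0p.le hN
        linarith
      rw [this, Finset.sum_const, hTcard, nsmul_eq_mul, ← ENNReal.ofReal_natCast, ← ENNReal.ofReal_mul (by positivity)]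
      push_cast; rfl
    · intro n hn m hm hnm
      apply Metric.closedBall_disjoint_closedBall
      rw [dist_eq_norm]
      have := hsep n hn m hm hnm
      linarith
    · intro n _; exact Metric.isClosed_closedBall.measurableSet
  have hE : ∀ t ∈ E, ∀ q ∈ S, ‖q • t‖ ≤ 1/6 := by
    intro t ht q hq
    simp only [hEdef, Set.mem_iUnion] at ht
    obtain ⟨n, hn, ht⟩ := ht
    rw [Metric.mem_closedBall, dist_eq_norm] at ht
    obtain ⟨hq1, hq2⟩ := Finset.mem_filter.1 hq
    have hqN : (q:ℝ) ≤ N := (Nat.le_floor_iff hN0.le).1 (Finset.mem_Icc.1 hq1).2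
    have e : q • t = q • (t - alph x n) + q • alph x n := by rw [smul_sub, sub_add_cancel]
    rw [e]
    have b1 : ‖q • (t - alph x n)‖ ≤ 1/12 := by
      refine norm_nsmul_le.trans ?_
      have : (q:ℝ) * ‖t - alph x n‖ ≤ N * w := by gcongr
      have h3 : N * w = w0 := by rw [hw]; field_simp
      have h1 := min_le_left (1/12:ℝ) (c/3)
      linarith
    have b2 : ‖q • alph x n‖ ≤ 1/12 := by
      rw [alph_eq, Finset.smul_sum]
      refine (norm_sum_le _ _).trans ?_
      have : ∀ i ∈ Finset.univ, ‖q • n i • (x i : UnitAddCircle)‖ ≤ M * δ := by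
        intro i _
        have h1 := hTmem n hn i
        rw [smul_comm]
        have h2 := aux_distInt _ _ hq2 i
        have h3 : (((q:ℝ) * x i : ℝ) : UnitAddCircle) = q • (x i : UnitAddCircle) := by
          rw [← nsmul_eq_mul]; rfl
        rw [h3] at h2
        refine (norm_zsmul_le _ _).trans ?_
        gcongr
        rw [Int.norm_eq_abs, abs_of_nonneg (by exact_mod_cast h1.1)]
        exact_mod_cast h1.2
      refine (Finset.sum_le_sum this).trans ?_
      rw [Finset.sum_const, Finset.card_univ, Fintype.card_fin, nsmul_eq_mul]
      calc (l:ℝ) * (M * δ) ≤ l * (1 / (12 * l * δ) * δ) := by gcongr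
        _ = 1/12 := by field_simp
    exact (norm_add_le _ _).trans (by linarith)
  have hfinal := aux_core S E hEm hE
  rw [hvol, ENNReal.toReal_ofReal (by positivity)] at hfinal
  have hlow : (1 / (12 * l * δ))^l ≤ ((M:ℝ)+1)^l := by gcongr
  have h5 : (1 / (12 * l * δ))^l * (2*w) * S.card ≤ 4 := le_trans (by gcongr) hfinal
  have hD : (0:ℝ) < (12 * l * δ)^l := by positivity
  rw [one_div, inv_pow, hw] at h5
  have e1 : ((12 * l * δ)^l)⁻¹ * (2*(w0/N)) * (S.card:ℝ) = (S.card:ℝ) * (2*w0) / (N * (12 * l * δ)^l) := by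
    field_simp
  rw [e1, div_le_iff₀ (by positivity)] at h5
  have e2 : 4 / (2 * w0) * (12 * (l:ℝ)) ^ l * N * δ ^ l = 4 * (N * (12 * l * δ)^l) / (2*w0) := by
    rw [mul_pow]; ring
  rw [e2, le_div_iff₀ (by positivity)]
  exact h5

theorem stmt_14 (l d : ℕ) (hd : d = l + 1) (hd2 : 2 ≤ d) (x : Fin l → ℝ)
    (htype : tauD x < (d : ℝ≥0∞))
    (ψ : ℕ → ℝ) (hψpos : ∀ q, 0 < ψ q)
    (hψlow : ∀ ε : ℝ, 0 < ε → ∀ᶠ q : ℕ in atTop, (q : ℝ) ^ (-(1 / d : ℝ) - ε) ≤ ψ q)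
    (k : ℕ) (hk : 2 ≤ k) (L : ℤ) :
    ∃ C : ℝ, 0 < C ∧ ∃ j₀ : ℕ, ∀ j : ℕ, j₀ ≤ j →
      (((Finset.Icc 1 (Nat.floor ((k : ℝ) ^ ((j : ℤ) + L)))).filter fun q : ℕ =>
          distInt (fun i => (q : ℝ) * x i) < ψ (k ^ j)).card : ℝ) ≤
        C * (k : ℝ) ^ ((j : ℤ) + L) * ψ (k ^ j) ^ (d - 1) := by

  obtain ⟨τ, hτ0, hτd, c, hc, hdio⟩ := aux_dioph (by omega) x htype
  have hl : 0 < l := by omega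
  obtain ⟨C, hC, hcount⟩ := aux_count hl x τ c hτ0 hc hdio
  refine ⟨C, hC, ?_⟩
  have hd0 : (0:ℝ) < d := by linarith
  set ε : ℝ := (1/τ - 1/d)/2 with hε
  have hε0 : 0 < ε := by
    have := one_div_lt_one_div_of_lt hτ0 hτd
    rw [hε]; linarith
  have hkR : (1:ℝ) < k := by exact_mod_cast (by omega : 1 < k)
  have htend : Tendsto (fun j : ℕ => k ^ j) atTop atTop := tendsto_pow_atTop_atTop_of_one_lt (by omega)
  have hev := htend.eventually (hψlow ε hε0)
  obtain ⟨j1, hj1⟩ := eventually_atTop.1 hev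
  set θ : ℝ := (1/d + ε) * τ with hθ
  have hθ1 : θ < 1 := by
    have h1 : θ = (1 + τ/d)/2 := by rw [hθ, hε]; field_simp; ring
    have h2 : τ / d < 1 := (div_lt_one hd0).2 hτd
    linarith
  obtain ⟨j2, hj2⟩ := exists_nat_ge (|(L:ℝ)| / (1-θ))
  refine ⟨max j1 (max j2 L.natAbs), fun j hj => ?_⟩
  have hja : j1 ≤ j := le_trans (le_max_left _ _) hj
  have hjb : j2 ≤ j := le_trans ((le_max_left _ _).trans (le_max_right _ _)) hj
  have hjc : L.natAbs ≤ j := le_trans ((le_max_right _ _).trans (le_max_right _ _)) hj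
  have hd1 : d - 1 = l := by omega
  rw [hd1]
  apply hcount
  · exact one_le_zpow₀ hkR.le (by omega)
  · exact hψpos _
  · have h1 := hj1 j hja
    have h2 : ((k:ℝ)^((j:ℤ)+L))⁻¹ ≤ (((k^j : ℕ):ℝ) ^ (-(1 / d : ℝ) - ε)) ^ τ := by
      rw [← Real.rpow_intCast, ← Real.rpow_neg (by linarith), Nat.cast_pow, ← Real.rpow_natCast,
        ← Real.rpow_mul (by positivity), ← Real.rpow_mul (by linarith)]
      apply Real.rpow_le_rpow_of_exponent_le hkR.le
      push_cast
      have h3 : (j:ℝ) * ((-(1 / d : ℝ) - ε) * τ) = - (j * θ) := by rw [hθ]; ring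
      rw [h3]
      have h4 : |(L:ℝ)| ≤ j * (1-θ) := by
        rw [← div_le_iff₀ (by linarith)]
        exact hj2.trans (by exact_mod_cast hjb)
      have := neg_abs_le (L:ℝ)
      linarith
    refine h2.trans ?_
    exact Real.rpow_le_rpow (by positivity) h1 hτ0.le
end
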